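/- arXiv:2007.12366 — 5 statements merged into one kernel-verified Lean document; each statement's English description precedes it below -/
import Mathlib

section
/- Let K ≥ 2, let w_1,…,w_K > 0 with Σ_{i=1}^K w_i = 1, and let U_1,…,U_K be standard uniform random variables such that for each 1 ≤ i < j ≤ K the pair (Φ^{−1}(U_i), Φ^{−1}(U_j)) is bivariate Gaussian with correlation σ_{ij} < 1, where Φ is the standard normal cdf. Then P(Σ_{i=1}^K w_i U_i^{−1} > 1/ε) ∼ ε as ε ↓ 0, where A_ε ∼ B_ε means A_ε/B_ε → 1. -/
open MeasureTheory ProbabilityTheory Real Set Filter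

/-- The uniform probability measure on `[0,1]`. -/
noncomputable def unif01 : MeasureTheory.Measure ℝ :=
  MeasureTheory.volume.restrict (Set.Icc (0:ℝ) 1)

/-- `U` is uniformly distributed on `[0,1]` under `P`. -/
def IsUnif {Ω : Type*} [MeasurableSpace Ω] (P : MeasureTheory.Measure Ω) (U : Ω → ℝ) : Prop :=
  Measurable U ∧ MeasureTheory.Measure.map U P = unif01

/-- standard normal quantile function `Φ⁻¹`. -/
noncomputable def normQuantile (p : ℝ) : ℝ :=
  sInf {x : ℝ | p ≤ ((ProbabilityTheory.gaussianReal 0 1) (Set.Iic x)).toReal}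

/-- `(X, Y)` is a bivariate Gaussian vector with standard normal marginals and
correlation `σ` under `P`: its joint distribution is the image of two independent
standard normals `(z₁, z₂)` under `(z₁, σ z₁ + √(1-σ²) z₂)`. -/
def IsStdGaussianPairWithCorr {Ω : Type*} [MeasurableSpace Ω]
    (P : MeasureTheory.Measure Ω) (X Y : Ω → ℝ) (σ : ℝ) : Prop :=
  MeasureTheory.Measure.map (fun ω => (X ω, Y ω)) P =
    MeasureTheory.Measure.map
      (fun z : ℝ × ℝ => (z.1, σ * z.1 + Real.sqrt (1 - σ^2) * z.2))
      ((ProbabilityTheory.gaussianReal 0 1).prod (ProbabilityTheory.gaussianReal 0 1))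

/-- Chernoff bound for the sum of a correlated standard Gaussian pair. -/
lemma IsStdGaussianPairWithCorr.measureReal_le_le {Ω : Type*} [MeasurableSpace Ω]
    {P : Measure Ω} {X Y : Ω → ℝ} {σ : ℝ} (hσ : σ ∈ Icc (-1 : ℝ) 1)
    (h : IsStdGaussianPairWithCorr P X Y σ) {y : ℝ} (hy : y ≤ 0) :
    P.real {ω | X ω ≤ y ∧ Y ω ≤ y} ≤ rexp (-((3 - σ) / 4 * y ^ 2)) := by
  unfold IsStdGaussianPairWithCorr at h
  set ν : Measure (ℝ × ℝ) := (gaussianReal 0 1).prod (gaussianReal 0 1) with hν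
  set b := √(1 - σ ^ 2) with hb
  have hg : Measurable (fun z : ℝ × ℝ => (z.1, σ * z.1 + b * z.2)) := by fun_prop
  have : IsProbabilityMeasure (ν.map (fun z : ℝ × ℝ => (z.1, σ * z.1 + b * z.2))) :=
    Measure.isProbabilityMeasure_map hg.aemeasurable
  have hXY : AEMeasurable (fun ω => (X ω, Y ω)) P := by
    apply aemeasurable_of_map_neZero
    rw [h]
    infer_instance
  have hs : MeasurableSet {p : ℝ × ℝ | p.1 ≤ y ∧ p.2 ≤ y} :=
    (measurableSet_le measurable_fst measurable_const).inter
      (measurableSet_le measurable_snd measurable_const)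
  have hEq : P.real {ω | X ω ≤ y ∧ Y ω ≤ y} =
      ν.real {z : ℝ × ℝ | z.1 ≤ y ∧ σ * z.1 + b * z.2 ≤ y} := by
    have h' := congrArg (fun μ : Measure (ℝ × ℝ) => μ {p : ℝ × ℝ | p.1 ≤ y ∧ p.2 ≤ y}) h
    simp only [Measure.map_apply_of_aemeasurable hXY hs, Measure.map_apply hg hs] at h'
    exact congrArg ENNReal.toReal h'
  have hexp : (fun z : ℝ × ℝ => rexp (y / 2 * ((1 + σ) * z.1 + b * z.2))) =
      fun z => rexp ((y / 2 * (1 + σ)) * z.1) * rexp ((y / 2 * b) * z.2) := by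
    ext z
    rw [← Real.exp_add]
    ring_nf
  have hint : Integrable (fun z : ℝ × ℝ => rexp (y / 2 * ((1 + σ) * z.1 + b * z.2))) ν := by
    rw [hexp]
    exact (integrable_exp_mul_gaussianReal _).mul_prod (integrable_exp_mul_gaussianReal _)
  have hm (t : ℝ) : ∫ x, rexp (t * x) ∂gaussianReal 0 1 = rexp (t ^ 2 / 2) := by
    have := congrFun (mgf_fun_id_gaussianReal (μ := 0) (v := 1)) t
    simpa [mgf] using this
  have hmgf : mgf (fun z : ℝ × ℝ => (1 + σ) * z.1 + b * z.2) ν (y / 2) =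
      rexp ((1 + σ) / 4 * y ^ 2) := by
    have hb2 : b ^ 2 = 1 - σ ^ 2 := Real.sq_sqrt (by nlinarith [hσ.1, hσ.2])
    rw [mgf, hexp, hν, integral_prod_mul (fun x => rexp ((y / 2 * (1 + σ)) * x))
      (fun x => rexp ((y / 2 * b) * x)), hm, hm, ← Real.exp_add]
    congr 1
    linear_combination y ^ 2 / 8 * hb2
  calc P.real {ω | X ω ≤ y ∧ Y ω ≤ y}
      ≤ ν.real {z : ℝ × ℝ | (1 + σ) * z.1 + b * z.2 ≤ 2 * y} := by
        rw [hEq]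
        refine measureReal_mono fun z hz => ?_
        simp only [mem_ofPred_eq] at hz ⊢
        linarith [hz.1, hz.2]
    _ ≤ rexp (-(y / 2) * (2 * y)) * mgf (fun z : ℝ × ℝ => (1 + σ) * z.1 + b * z.2) ν (y / 2) :=
        measure_le_le_exp_mul_mgf _ (by linarith) hint
    _ = rexp (-((3 - σ) / 4 * y ^ 2)) := by
        rw [hmgf, ← Real.exp_add]
        ring_nf

lemma gaussianPDFReal_le_measureReal_Iic {y : ℝ} (hy : y ≤ 0) :
    gaussianPDFReal 0 1 (y - 1) ≤ (gaussianReal 0 1).real (Iic y) := by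
  have h1 : ∫ x in Icc (y - 1) y, gaussianPDFReal 0 1 (y - 1) ≤
      ∫ x in Icc (y - 1) y, gaussianPDFReal 0 1 x := by
    refine setIntegral_mono_on (by simp) (integrable_gaussianPDFReal 0 1).integrableOn
      measurableSet_Icc fun x hx => ?_
    simp only [gaussianPDFReal_def]
    gcongr ?_ * rexp ?_
    simp only [NNReal.coe_one, sub_zero]
    nlinarith [hx.1, hx.2]
  have h2 : ∫ x in Icc (y - 1) y, gaussianPDFReal 0 1 x ≤ ∫ x in Iic y, gaussianPDFReal 0 1 x :=
    setIntegral_mono_set (integrable_gaussianPDFReal 0 1).integrableOn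
      (ae_of_all _ fun x => gaussianPDFReal_nonneg 0 1 x)
      (Eventually.of_forall fun x hx => hx.2)
  rw [measureReal_def, gaussianReal_apply_eq_integral 0 one_ne_zero, ENNReal.toReal_ofReal
    (integral_nonneg fun x => gaussianPDFReal_nonneg 0 1 x)]
  simpa using h1.trans h2

lemma bddBelow_setOf_le_gaussianReal_Iic {p : ℝ} (hp : 0 < p) :
    BddBelow {x : ℝ | p ≤ ((gaussianReal 0 1) (Iic x)).toReal} := by
  obtain ⟨a, ha⟩ := ((tendsto_cdf_atBot (gaussianReal 0 1)).eventually_lt_const hp).exists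
  refine ⟨a, fun x hx => ?_⟩
  by_contra! hlt
  rw [cdf_eq_real] at ha
  exact (hx.trans (measureReal_mono (Iic_subset_Iic.2 hlt.le))).not_gt ha

lemma normQuantile_le {p x : ℝ} (hp : 0 < p) (hx : p ≤ (gaussianReal 0 1).real (Iic x)) :
    normQuantile p ≤ x :=
  csInf_le (bddBelow_setOf_le_gaussianReal_Iic hp) hx

lemma measureReal_Iic_lt_of_lt_normQuantile {p x : ℝ} (hp : 0 < p) (hx : x < normQuantile p) :
    (gaussianReal 0 1).real (Iic x) < p := by
  by_contra! h
  exact (normQuantile_le hp h).not_gt hx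

lemma normQuantile_mono {p q : ℝ} (hp : 0 < p) (hpq : p ≤ q) (hq : q < 1) :
    normQuantile p ≤ normQuantile q := by
  obtain ⟨b, hb⟩ := ((tendsto_cdf_atTop (gaussianReal 0 1)).eventually_const_lt hq).exists
  rw [cdf_eq_real] at hb
  exact csInf_le_csInf (bddBelow_setOf_le_gaussianReal_Iic hp) ⟨b, hb.le⟩
    fun x hx => hpq.trans hx

lemma tendsto_normQuantile_nhdsGT_zero : Tendsto normQuantile (nhdsWithin 0 (Ioi 0)) atBot := by
  refine tendsto_atBot.2 fun b => ?_
  have hpos : 0 < (gaussianReal 0 1).real (Iic (min b 0)) :=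
    (gaussianPDFReal_pos 0 1 _ one_ne_zero).trans_le
      (gaussianPDFReal_le_measureReal_Iic (min_le_right b 0))
  filter_upwards [self_mem_nhdsWithin, nhdsWithin_le_nhds (eventually_le_nhds hpos)] with u hu hu'
  exact (normQuantile_le hu hu').trans (min_le_left b 0)

lemma IsUnif.ae_mem_Ioc {Ω : Type*} [MeasurableSpace Ω] {P : Measure Ω} {U : Ω → ℝ}
    (hU : IsUnif P U) : ∀ᵐ ω ∂P, U ω ∈ Ioc (0 : ℝ) 1 := by
  refine ae_of_ae_map hU.1.aemeasurable ?_
  rw [hU.2, unif01, ← Measure.restrict_congr_set Ioc_ae_eq_Icc]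
  exact ae_restrict_mem measurableSet_Ioc

lemma IsUnif.measureReal_lt {Ω : Type*} [MeasurableSpace Ω] {P : Measure Ω} {U : Ω → ℝ}
    (hU : IsUnif P U) {a : ℝ} (ha : 0 ≤ a) : P.real {ω | U ω < a} = min a 1 := by
  have h : P.real {ω | U ω < a} = (P.map U).real (Iio a) :=
    (map_measureReal_apply hU.1 measurableSet_Iio).symm
  rw [h, hU.2, unif01, measureReal_restrict_apply measurableSet_Iio, inter_comm,
    measureReal_congr (ae_eq_set_inter (Ico_ae_eq_Icc (a := (0:ℝ)) (b := 1)).symm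
      (ae_eq_refl (Iio a))), Ico_inter_Iio]
  rw [measureReal_def, Real.volume_Ico, sub_zero, ENNReal.toReal_ofReal (le_min zero_le_one ha),
    min_comm]

open scoped Topology in
/-- Asymptotic tail independence of the Gaussian copula with correlation less than one. -/
lemma IsUnif.tendsto_measureReal_lt_and_lt_div {Ω : Type*} [MeasurableSpace Ω] {P : Measure Ω}
    [IsProbabilityMeasure P] {U V : Ω → ℝ} (hU : IsUnif P U) (hV : IsUnif P V) {σ : ℝ}
    (hσ : σ ∈ Icc (-1 : ℝ) 1) (hσ1 : σ < 1)
    (h : IsStdGaussianPairWithCorr P (fun ω => normQuantile (U ω))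
      (fun ω => normQuantile (V ω)) σ) :
    Tendsto (fun u => P.real {ω | U ω < u ∧ V ω < u} / u) (𝓝[>] 0) (𝓝 0) := by
  have hquad : Tendsto (fun y : ℝ => y * (-((1 - σ) / 4) * y - 2)) atBot atBot := by
    refine tendsto_id.atBot_mul_atTop₀ (tendsto_atTop_add_const_right _ _ ?_)
    exact tendsto_id.const_mul_atBot_of_neg (by linarith)
  have hlim : Tendsto (fun y : ℝ => √(2 * π) * (rexp (y * (-((1 - σ) / 4) * y - 2)) * rexp 2))
      atBot (𝓝 0) := by
    simpa using ((Real.tendsto_exp_atBot.comp hquad).mul_const (rexp 2)).const_mul (√(2 * π))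
  refine squeeze_zero' ?_ ?_ (hlim.comp tendsto_normQuantile_nhdsGT_zero)
  · filter_upwards [self_mem_nhdsWithin] with u hu
    exact div_nonneg measureReal_nonneg (le_of_lt hu)
  filter_upwards [self_mem_nhdsWithin, nhdsWithin_le_nhds (eventually_lt_nhds one_pos),
    tendsto_normQuantile_nhdsGT_zero.eventually (eventually_le_atBot 0)] with u hu hu1 hy
  set y := normQuantile u with hyu
  have hnum : P.real {ω | U ω < u ∧ V ω < u} ≤ rexp (-((3 - σ) / 4 * y ^ 2)) := by
    refine le_trans ?_ (h.measureReal_le_le hσ hy)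
    refine ENNReal.toReal_mono (measure_ne_top _ _) (measure_mono_ae ?_)
    filter_upwards [hU.ae_mem_Ioc, hV.ae_mem_Ioc] with ω hω hω' hlt
    exact ⟨normQuantile_mono hω.1 hlt.1.le hu1, normQuantile_mono hω'.1 hlt.2.le hu1⟩
  have hden : gaussianPDFReal 0 1 (y - 2) ≤ u := by
    have h1 := gaussianPDFReal_le_measureReal_Iic (y := y - 1) (by linarith)
    have h2 := measureReal_Iic_lt_of_lt_normQuantile hu (sub_one_lt y)
    rw [show y - 1 - 1 = y - 2 by ring] at h1
    exact h1.trans h2.le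
  have hpos := gaussianPDFReal_pos 0 1 (y - 2) one_ne_zero
  calc P.real {ω | U ω < u ∧ V ω < u} / u
      ≤ rexp (-((3 - σ) / 4 * y ^ 2)) / gaussianPDFReal 0 1 (y - 2) := by gcongr
    _ = √(2 * π) * (rexp (y * (-((1 - σ) / 4) * y - 2)) * rexp 2) := by
        rw [div_eq_iff hpos.ne', gaussianPDFReal_def]
        have hc : √(2 * π) ≠ 0 := by positivity
        simp only [NNReal.coe_one, mul_one, sub_zero]
        rw [show √(2 * π) * (rexp (y * (-((1 - σ) / 4) * y - 2)) * rexp 2) *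
          ((√(2 * π))⁻¹ * rexp (-(y - 2) ^ 2 / 2)) =
          (√(2 * π) * (√(2 * π))⁻¹) * (rexp (y * (-((1 - σ) / 4) * y - 2)) * rexp 2 *
            rexp (-(y - 2) ^ 2 / 2)) by ring, mul_inv_cancel₀ hc, one_mul, ← Real.exp_add,
          ← Real.exp_add]
        ring_nf

/-- If a finite sum is large, then one term is large or two distinct terms are moderately large. -/
lemma exists_lt_or_exists_pair_lt_of_lt_sum {ι : Type*} [Fintype ι] [Nonempty ι] {x : ι → ℝ}
    {s t : ℝ} (hs : 0 ≤ s) (h : t + Fintype.card ι * s < ∑ i, x i) :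
    (∃ i, t < x i) ∨ ∃ i j, j ≠ i ∧ s < x i ∧ s < x j := by
  classical
  by_contra! hcon
  obtain ⟨hone, hpair⟩ := hcon
  obtain ⟨m, hm⟩ := Finite.exists_max x
  have hrest : ∑ j ∈ Finset.univ.erase m, x j ≤ Fintype.card ι * s := by
    calc ∑ j ∈ Finset.univ.erase m, x j ≤ ∑ j ∈ Finset.univ.erase m, s := by
          refine Finset.sum_le_sum fun j hj => ?_
          by_contra! hlt
          exact (hpair m j (Finset.ne_of_mem_erase hj) (hlt.trans_le (hm j))).not_gt hlt
      _ ≤ ∑ j : ι, s := Finset.sum_le_sum_of_subset_of_nonneg (Finset.erase_subset _ _)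
          fun _ _ _ => hs
      _ = Fintype.card ι * s := by simp
  rw [← Finset.add_sum_erase _ _ (Finset.mem_univ m)] at h
  linarith [hone m]

/-- Bonferroni's lower bound for the measure of a finite union. -/
lemma sum_measureReal_le_measureReal_iUnion_add {Ω ι : Type*} [MeasurableSpace Ω] [Fintype ι]
    [DecidableEq ι] {P : Measure Ω} [IsFiniteMeasure P] {A : ι → Set Ω}
    (hA : ∀ i, MeasurableSet (A i)) :
    ∑ i, P.real (A i) ≤
      P.real (⋃ i, A i) + ∑ i, ∑ j ∈ Finset.univ.erase i, P.real (A i ∩ A j) := by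
  set B : ι → Set Ω := fun i => A i \ ⋃ j ∈ Finset.univ.erase i, A j with hB
  have hmeas (i : ι) : MeasurableSet (⋃ j ∈ Finset.univ.erase i, A j) :=
    Finset.measurableSet_biUnion _ fun j _ => hA j
  have hdisj : Pairwise (Function.onFun Disjoint B) := fun i j hij =>
    Set.disjoint_left.2 fun ω hi hj => hj.2 <| mem_biUnion (by simpa using hij) hi.1
  have hle (i : ι) : P.real (A i) ≤
      P.real (B i) + ∑ j ∈ Finset.univ.erase i, P.real (A i ∩ A j) := by
    rw [← measureReal_sdiff_add_inter (hmeas i)]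
    gcongr
    rw [inter_iUnion₂]
    exact measureReal_biUnion_finset_le _ _
  calc ∑ i, P.real (A i)
      ≤ ∑ i, P.real (B i) + ∑ i, ∑ j ∈ Finset.univ.erase i, P.real (A i ∩ A j) := by
        rw [← Finset.sum_add_distrib]
        exact Finset.sum_le_sum fun i _ => hle i
    _ ≤ _ := by
        rw [← measureReal_iUnion_fintype hdisj fun i => (hA i).diff (hmeas i)]
        gcongr ?_ + _
        exact measureReal_mono (iUnion_mono fun i => sdiff_subset)

/-- for positive weights summing to one and pairwise bivariate Gaussian
copula with correlations `σ_{ij} < 1`,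
`P(Σ w_i U_i⁻¹ > 1/ε) ∼ ε` as `ε ↓ 0`. -/
theorem weighted_harmonic_tail
    {Ω : Type*} [MeasurableSpace Ω] (P : MeasureTheory.Measure Ω)
    [MeasureTheory.IsProbabilityMeasure P]
    (K : ℕ) (hK : 2 ≤ K) (w : Fin K → ℝ) (hw : ∀ i, 0 < w i)
    (hw1 : ∑ i, w i = 1)
    (U : Fin K → Ω → ℝ) (hU : ∀ i, IsUnif P (U i))
    (hG : ∀ i j : Fin K, i < j → ∃ σ : ℝ, σ ∈ Set.Icc (-1 : ℝ) 1 ∧ σ < 1 ∧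
      IsStdGaussianPairWithCorr P
        (fun ω => normQuantile (U i ω)) (fun ω => normQuantile (U j ω)) σ) :
    Filter.Tendsto
      (fun ε : ℝ => (P {ω | 1/ε < ∑ i, w i * (U i ω)⁻¹}).toReal / ε)
      (nhdsWithin 0 (Set.Ioi 0)) (nhds 1) := by

  classical
  have : Nonempty (Fin K) := ⟨⟨0, by omega⟩⟩
  have hwle (i : Fin K) : w i ≤ 1 :=
    hw1 ▸ Finset.single_le_sum (fun j _ => (hw j).le) (Finset.mem_univ i)
  have hpos : ∀ᵐ ω ∂P, ∀ i, U i ω ∈ Ioc (0 : ℝ) 1 := ae_all_iff.2 fun i => (hU i).ae_mem_Ioc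
  have hpair (i j : Fin K) (hij : j ≠ i) :
      Tendsto (fun u => P.real {ω | U i ω < u ∧ U j ω < u} / u) (nhdsWithin 0 (Ioi 0)) (nhds 0) := by
    rcases lt_or_gt_of_ne hij with h | h
    · obtain ⟨σ, hσ, hσ1, hG'⟩ := hG j i h
      simp_rw [and_comm (a := U i _ < _)]
      exact (hU j).tendsto_measureReal_lt_and_lt_div (hU i) hσ hσ1 hG'
    · obtain ⟨σ, hσ, hσ1, hG'⟩ := hG i j h
      exact (hU i).tendsto_measureReal_lt_and_lt_div (hU j) hσ hσ1 hG'
  have hrem (c : ℝ) (hc : 0 < c) : Tendsto (fun ε => ∑ i, ∑ j ∈ Finset.univ.erase i,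
      P.real {ω | U i ω < c * ε ∧ U j ω < c * ε} / ε) (nhdsWithin 0 (Ioi 0)) (nhds 0) := by
    rw [show (0 : ℝ) = ∑ i : Fin K, ∑ j ∈ Finset.univ.erase i, (0 : ℝ) by simp]
    refine tendsto_finsetSum _ fun i _ => tendsto_finsetSum _ fun j hj => ?_
    have hcε : Tendsto (fun ε : ℝ => c * ε) (nhdsWithin 0 (Ioi 0)) (nhdsWithin 0 (Ioi 0)) := by
      refine tendsto_nhdsWithin_iff.2 ⟨?_, ?_⟩
      · refine Tendsto.mono_left ?_ nhdsWithin_le_nhds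
        simpa using (continuous_const_mul c).tendsto 0
      · filter_upwards [self_mem_nhdsWithin] with ε hε using mul_pos hc hε
    have := ((hpair i j (Finset.ne_of_mem_erase hj)).comp hcε).const_mul c
    rw [mul_zero] at this
    simp only [Finset.sum_const_zero]
    refine this.congr' ?_
    filter_upwards [self_mem_nhdsWithin] with ε hε
    have hε0 : ε ≠ 0 := ne_of_gt hε
    simp only [Function.comp_apply]
    field_simp
  refine tendsto_order.2 ⟨fun v hv => ?_, fun v hv => ?_⟩
  · filter_upwards [self_mem_nhdsWithin, nhdsWithin_le_nhds (eventually_lt_nhds one_pos),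
      (hrem 1 one_pos).eventually_lt_const (sub_pos.2 hv)] with ε (hε : 0 < ε) hε1 hr
    have hbon := sum_measureReal_le_measureReal_iUnion_add (P := P)
      (A := fun i => {ω | U i ω < w i * ε}) fun i => measurableSet_lt (hU i).1 measurable_const
    have hsum : ∑ i, P.real {ω | U i ω < w i * ε} = ε := by
      calc ∑ i, P.real {ω | U i ω < w i * ε} = ∑ i, w i * ε := by
            refine Finset.sum_congr rfl fun i _ => ?_
            rw [(hU i).measureReal_lt (mul_pos (hw i) hε).le, min_eq_left]
            exact mul_le_one₀ (hwle i) hε.le hε1.le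
        _ = ε := by rw [← Finset.sum_mul, hw1, one_mul]
    have hunion : P.real (⋃ i, {ω | U i ω < w i * ε}) ≤
        P.real {ω | 1 / ε < ∑ i, w i * (U i ω)⁻¹} := by
      refine ENNReal.toReal_mono (measure_ne_top _ _) (measure_mono_ae ?_)
      filter_upwards [hpos] with ω hω hmem
      obtain ⟨i, hi⟩ := mem_iUnion.1 hmem
      refine lt_of_lt_of_le ?_ (Finset.single_le_sum
        (fun j _ => mul_nonneg (hw j).le (inv_nonneg.2 (hω j).1.le)) (Finset.mem_univ i))
      rw [← div_eq_mul_inv, div_lt_div_iff₀ hε (hω i).1, one_mul]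
      exact hi
    have hinter : ∑ i, ∑ j ∈ Finset.univ.erase i,
        P.real ({ω | U i ω < w i * ε} ∩ {ω | U j ω < w j * ε}) ≤
        ∑ i, ∑ j ∈ Finset.univ.erase i, P.real {ω | U i ω < 1 * ε ∧ U j ω < 1 * ε} := by
      refine Finset.sum_le_sum fun i _ => Finset.sum_le_sum fun j _ => measureReal_mono ?_
      rintro ω ⟨hi, hj⟩
      exact ⟨lt_of_lt_of_le hi (by gcongr; exact hwle i),
        lt_of_lt_of_le hj (by gcongr; exact hwle j)⟩
    simp_rw [← Finset.sum_div] at hr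
    rw [div_lt_iff₀ hε] at hr
    rw [lt_div_iff₀ hε]
    change _ < P.real _
    linarith
  · set q := (1 + v) / 2 with hq
    have hq1 : 1 < q := by linarith
    set c := K * q / (q - 1) with hc
    have hK0 : (0 : ℝ) < K := by exact_mod_cast (by omega : 0 < K)
    have hq10 : 0 < q - 1 := by linarith
    have hc0 : 0 < c := by positivity
    filter_upwards [self_mem_nhdsWithin,
      (hrem c hc0).eventually_lt_const (show 0 < v - q by linarith)] with ε (hε : 0 < ε) hr
    have hlt (i : Fin K) {ω : Ω} (hω : U i ω ∈ Ioc (0 : ℝ) 1) {a : ℝ} (ha : 0 < a)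
        (h : 1 / (a * ε) < w i * (U i ω)⁻¹) : U i ω < w i * (a * ε) := by
      rwa [← div_eq_mul_inv, div_lt_div_iff₀ (by positivity) hω.1, one_mul] at h
    have hcover : P.real {ω | 1 / ε < ∑ i, w i * (U i ω)⁻¹} ≤
        P.real ((⋃ i, {ω | U i ω < w i * (q * ε)}) ∪
          ⋃ i, ⋃ j ∈ Finset.univ.erase i, {ω | U i ω < c * ε ∧ U j ω < c * ε}) := by
      refine ENNReal.toReal_mono (measure_ne_top _ _) (measure_mono_ae ?_)
      filter_upwards [hpos] with ω hω (hmem : 1 / ε < ∑ i, w i * (U i ω)⁻¹)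
      have hsplit : 1 / (q * ε) + Fintype.card (Fin K) * (1 / (c * ε)) = 1 / ε := by
        rw [Fintype.card_fin, hc]
        field_simp
        ring
      rw [← hsplit] at hmem
      rcases exists_lt_or_exists_pair_lt_of_lt_sum (by positivity) hmem with
        ⟨i, hi⟩ | ⟨i, j, hij, hi, hj⟩
      · exact Or.inl (mem_iUnion.2 ⟨i, hlt i (hω i) (by linarith) hi⟩)
      · have hcε : 0 ≤ c * ε := by positivity
        refine Or.inr (mem_iUnion.2 ⟨i, mem_iUnion₂.2 ⟨j, by simpa using hij, ?_, ?_⟩⟩)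
        · exact (hlt i (hω i) hc0 hi).trans_le (mul_le_of_le_one_left hcε (hwle i))
        · exact (hlt j (hω j) hc0 hj).trans_le (mul_le_of_le_one_left hcε (hwle j))
    have hone : P.real (⋃ i, {ω | U i ω < w i * (q * ε)}) ≤ q * ε := by
      calc P.real (⋃ i, {ω | U i ω < w i * (q * ε)})
          ≤ ∑ i, P.real {ω | U i ω < w i * (q * ε)} := measureReal_iUnion_fintype_le _
        _ ≤ ∑ i, w i * (q * ε) := by
            refine Finset.sum_le_sum fun i _ => ?_
            rw [(hU i).measureReal_lt (mul_nonneg (hw i).le (by positivity))]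
            exact min_le_left _ _
        _ = q * ε := by rw [← Finset.sum_mul, hw1, one_mul]
    have htwo : P.real (⋃ i, ⋃ j ∈ Finset.univ.erase i, {ω | U i ω < c * ε ∧ U j ω < c * ε}) ≤
        ∑ i, ∑ j ∈ Finset.univ.erase i, P.real {ω | U i ω < c * ε ∧ U j ω < c * ε} :=
      (measureReal_iUnion_fintype_le _).trans
        (Finset.sum_le_sum fun i _ => measureReal_biUnion_finset_le _ _)
    have hun := measureReal_union_le (μ := P) (⋃ i, {ω | U i ω < w i * (q * ε)})
      (⋃ i, ⋃ j ∈ Finset.univ.erase i, {ω | U i ω < c * ε ∧ U j ω < c * ε})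
    simp_rw [← Finset.sum_div] at hr
    rw [div_lt_iff₀ hε] at hr
    rw [div_lt_iff₀ hε]
    change P.real _ < _
    linarith
end

section
/- Fix K ≥ 2. Let a_C(ε) and a_H(ε) denote the VAD thresholds of the Cauchy combining function M_{C,K} and of the harmonic mean combining function M_{−1,K}, respectively. Then a_C(ε)/a_H(ε) → 1 as ε ↓ 0. -/
open MeasureTheory ProbabilityTheory Real Set Filter

instance : MeasureTheory.IsProbabilityMeasure unif01 := by
  constructor
  simp [unif01, Real.volume_Icc]

/-- Left `ε`-quantile of a random variable `X` under `P`: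
`q_ε(X) = inf {x : ε ≤ P(X ≤ x)}`. -/
noncomputable def lQuantile {Ω : Type*} [MeasurableSpace Ω] (P : MeasureTheory.Measure Ω)
    (X : Ω → ℝ) (ε : ℝ) : ℝ :=
  sInf {x : ℝ | ε ≤ (P {ω | X ω ≤ x}).toReal}

/-- The measure `P` is atomless: every non-null measurable set has a measurable subset of
different, nonzero measure. -/
def Atomless {Ω : Type*} [MeasurableSpace Ω] (P : MeasureTheory.Measure Ω) : Prop :=
  ∀ A, MeasurableSet A → P A ≠ 0 →
    ∃ B, B ⊆ A ∧ MeasurableSet B ∧ P B ≠ 0 ∧ P B ≠ P A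

/-- VAD threshold: infimum of left `ε`-quantiles of `F(U_1,…,U_K)` over all
uniformly distributed `U_1,…,U_K` on `[0,1]` with arbitrary joint dependence. -/
noncomputable def VAD {Ω : Type*} [MeasurableSpace Ω] (P : MeasureTheory.Measure Ω) (K : ℕ)
    (F : (Fin K → ℝ) → ℝ) (ε : ℝ) : ℝ :=
  sInf {y : ℝ | ∃ U : Fin K → Ω → ℝ, (∀ i, IsUnif P (U i)) ∧
    y = lQuantile P (fun ω => F (fun i => U i ω)) ε}

/-- VI threshold: left `ε`-quantile of `F(V_1,…,V_K)` for independent uniforms,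
realized via the product measure. -/
noncomputable def VI (K : ℕ) (F : (Fin K → ℝ) → ℝ) (ε : ℝ) : ℝ :=
  lQuantile (MeasureTheory.Measure.pi fun _ : Fin K => unif01) F ε

/-- VC threshold: left `ε`-quantile of `F(U,…,U)` for a single uniform `U`. -/
noncomputable def VC (K : ℕ) (F : (Fin K → ℝ) → ℝ) (ε : ℝ) : ℝ :=
  lQuantile unif01 (fun u => F (fun _ => u)) ε

/-- standard Cauchy quantile function. -/
noncomputable def cauchyQuantile (p : ℝ) : ℝ := Real.tan (π * (p - 1/2))

/-- standard Cauchy cdf. -/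
noncomputable def cauchyCdf (x : ℝ) : ℝ := Real.arctan x / π + 1/2

/-- Cauchy combining function `M_{C,K}`. -/
noncomputable def MCauchy (K : ℕ) (p : Fin K → ℝ) : ℝ :=
  cauchyCdf ((∑ i, cauchyQuantile (p i)) / (K : ℝ))

/-- harmonic mean combining function `M_{-1,K}`. -/
noncomputable def Mharm (K : ℕ) (p : Fin K → ℝ) : ℝ :=
  (K : ℝ) / (∑ i, (p i)⁻¹)

/-- A splitting of `A` whose smaller piece is at least half as large as in any other splitting. -/
theorem exists_measurableSet_split {Ω : Type*} [MeasurableSpace Ω] (P : Measure Ω)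
    [IsFiniteMeasure P] (A : Set Ω) :
    ∃ B, B ⊆ A ∧ MeasurableSet B ∧ ∀ B', B' ⊆ A → MeasurableSet B' →
      min (P.real B') (P.real (A \ B')) ≤ 2 * min (P.real B) (P.real (A \ B)) := by
  set S : Set ℝ := {r | ∃ B, B ⊆ A ∧ MeasurableSet B ∧ r = min (P.real B) (P.real (A \ B))} with hS
  have hbdd : BddAbove S := by
    refine ⟨P.real A, ?_⟩
    rintro r ⟨B, hB, -, rfl⟩
    exact (min_le_left _ _).trans (measureReal_mono hB)
  have hne : S.Nonempty := ⟨_, ∅, empty_subset _, MeasurableSet.empty, rfl⟩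
  rcases le_or_gt (sSup S) 0 with h | h
  · refine ⟨∅, empty_subset _, MeasurableSet.empty, fun B' hB' hm => ?_⟩
    have h1 := le_csSup hbdd ⟨B', hB', hm, rfl⟩
    have h2 : 0 ≤ min (P.real ∅) (P.real (A \ ∅)) := by positivity
    linarith
  · obtain ⟨r, ⟨B, hB, hm, rfl⟩, hr⟩ := exists_lt_of_lt_csSup hne (half_lt_self h)
    refine ⟨B, hB, hm, fun B' hB' hm' => ?_⟩
    have h1 := le_csSup hbdd ⟨B', hB', hm', rfl⟩
    linarith

/-- Binary code of the cell of `ω` after `n` rounds in which every cell `A` is divided into `g A`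
and its complement in `A`. -/
noncomputable def cellCode {Ω : Type*} (g : Set Ω → Set Ω) : ℕ → Ω → ℕ
  | 0, _ => 0
  | n + 1, ω => 2 * cellCode g n ω +
      (g (cellCode g n ⁻¹' {cellCode g n ω})).indicator (fun _ => 1) ω

theorem measurable_cellCode {Ω : Type*} [MeasurableSpace Ω] {g : Set Ω → Set Ω}
    (hg : ∀ A, MeasurableSet (g A)) (n : ℕ) : Measurable (cellCode g n) := by
  induction n with
  | zero => exact measurable_const
  | succ n ih =>
    have hs : MeasurableSet {ω | ω ∈ g (cellCode g n ⁻¹' {cellCode g n ω})} := by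
      have : {ω | ω ∈ g (cellCode g n ⁻¹' {cellCode g n ω})} =
          ⋃ k, cellCode g n ⁻¹' {k} ∩ g (cellCode g n ⁻¹' {k}) := by
        ext ω; simp
      rw [this]
      exact MeasurableSet.iUnion fun k =>
        (ih (measurableSet_singleton k)).inter (hg _)
    have : cellCode g (n + 1) = fun ω => 2 * cellCode g n ω +
        {ω | ω ∈ g (cellCode g n ⁻¹' {cellCode g n ω})}.indicator (fun _ => 1) ω := by
      ext ω; simp [cellCode, indicator]
    rw [this]
    exact (ih.const_mul 2).add (measurable_const.indicator hs)

theorem cellCode_succ_fiber {Ω : Type*} {g : Set Ω → Set Ω} (n : ℕ) (ω : Ω) :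
    cellCode g (n + 1) ⁻¹' {cellCode g (n + 1) ω} ⊆
        cellCode g n ⁻¹' {cellCode g n ω} ∩ g (cellCode g n ⁻¹' {cellCode g n ω}) ∨
      cellCode g (n + 1) ⁻¹' {cellCode g (n + 1) ω} ⊆
        cellCode g n ⁻¹' {cellCode g n ω} \ g (cellCode g n ⁻¹' {cellCode g n ω}) := by
  classical
  have key : ∀ ω', cellCode g (n + 1) ω' = cellCode g (n + 1) ω →
      cellCode g n ω' = cellCode g n ω ∧
      (ω' ∈ g (cellCode g n ⁻¹' {cellCode g n ω}) ↔
        ω ∈ g (cellCode g n ⁻¹' {cellCode g n ω})) := by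
    intro ω' h
    simp only [cellCode, indicator] at h
    have h1 : cellCode g n ω' = cellCode g n ω := by
      split_ifs at h <;> omega
    rw [h1] at h
    refine ⟨h1, ?_⟩
    split_ifs at h <;> first | tauto | omega
  by_cases hω : ω ∈ g (cellCode g n ⁻¹' {cellCode g n ω})
  · exact Or.inl fun ω' h => ⟨(key ω' h).1, (key ω' h).2.2 hω⟩
  · exact Or.inr fun ω' h => ⟨(key ω' h).1, fun hmem => hω ((key ω' h).2.1 hmem)⟩

/-- An atomless finite measure carries a random variable with a diffuse law. -/
theorem Atomless.exists_diffuse {Ω : Type*} [MeasurableSpace Ω] {P : Measure Ω}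
    [IsFiniteMeasure P] (hP : Atomless P) :
    ∃ Y : Ω → ℝ, Measurable Y ∧ ∀ x, P (Y ⁻¹' {x}) = 0 := by
  choose g hg using exists_measurableSet_split P
  have hX := measurable_cellCode (fun A => (hg A).2.1)
  have hc : Measurable fun ω n => cellCode g n ω := measurable_pi_lambda _ hX
  refine ⟨fun ω => embeddingReal (ℕ → ℕ) (fun n => cellCode g n ω),
    (measurable_embeddingReal _).comp hc, fun x => ?_⟩
  set A : Set Ω := (fun ω => embeddingReal (ℕ → ℕ) (fun n => cellCode g n ω)) ⁻¹' {x} with hAdef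
  have hA : MeasurableSet A := ((measurable_embeddingReal _).comp hc) (measurableSet_singleton x)
  by_contra hpos
  obtain ⟨B, hBA, hB, hB0, hB1⟩ := hP A hA hpos
  obtain ⟨ω, hω⟩ : A.Nonempty := nonempty_of_measure_ne_zero hpos
  have hsub : ∀ n, A ⊆ cellCode g n ⁻¹' {cellCode g n ω} := by
    intro n ω' hω'
    have h : (fun n => cellCode g n ω') = fun n => cellCode g n ω :=
      (measurableEmbedding_embeddingReal _).injective (hω'.trans hω.symm)
    exact congrFun h n
  set s := min (P.real B) (P.real (A \ B)) with hs
  have hspos : 0 < s := by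
    refine lt_min (ENNReal.toReal_pos hB0 (measure_ne_top _ _)) ?_
    rw [measureReal_sdiff hBA hB, sub_pos, measureReal_def, measureReal_def,
      ENNReal.toReal_lt_toReal (measure_ne_top _ _) (measure_ne_top _ _)]
    exact lt_of_le_of_ne (measure_mono hBA) hB1
  have hstep : ∀ n, P.real (cellCode g (n + 1) ⁻¹' {cellCode g (n + 1) ω}) ≤
      P.real (cellCode g n ⁻¹' {cellCode g n ω}) - s / 2 := by
    intro n
    obtain ⟨h1, h2, h3⟩ := hg (cellCode g n ⁻¹' {cellCode g n ω})
    have h4 := h3 B (hBA.trans (hsub n)) hB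
    have h5 : s ≤ min (P.real B) (P.real (cellCode g n ⁻¹' {cellCode g n ω} \ B)) :=
      min_le_min_left _ (measureReal_mono (sdiff_subset_sdiff_left (hsub n)))
    have h6 := measureReal_sdiff (μ := P) h1 h2
    have h7 := min_le_left (P.real (g (cellCode g n ⁻¹' {cellCode g n ω})))
      (P.real (cellCode g n ⁻¹' {cellCode g n ω} \ g (cellCode g n ⁻¹' {cellCode g n ω})))
    have h8 := min_le_right (P.real (g (cellCode g n ⁻¹' {cellCode g n ω})))
      (P.real (cellCode g n ⁻¹' {cellCode g n ω} \ g (cellCode g n ⁻¹' {cellCode g n ω})))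
    rcases cellCode_succ_fiber (g := g) n ω with h | h
    · have := measureReal_mono (μ := P) (h.trans inter_subset_right)
      linarith
    · have := measureReal_mono (μ := P) h
      linarith
  have hlin : ∀ n : ℕ, P.real (cellCode g n ⁻¹' {cellCode g n ω}) ≤
      P.real univ - n * (s / 2) := by
    intro n
    induction n with
    | zero => simpa using measureReal_mono (subset_univ _)
    | succ n ih =>
      have := hstep n
      push_cast
      linarith
  obtain ⟨n, hn⟩ := exists_nat_gt (P.real univ / (s / 2))
  rw [div_lt_iff₀ (by positivity)] at hn
  have h1 := hlin n
  have h2 : 0 ≤ P.real (cellCode g n ⁻¹' {cellCode g n ω}) := measureReal_nonneg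
  linarith

theorem continuous_measureReal_Iic {m : Measure ℝ} [IsFiniteMeasure m] (hm : ∀ x, m {x} = 0) :
    Continuous fun t => m.real (Iic t) := by
  have : NullSingletonClass m := ⟨hm⟩
  have h : (fun t => m.real (Iic t)) =
      fun t => (∫ _ in (0:ℝ)..t, (1:ℝ) ∂m) + m.real (Iic 0) := by
    ext t
    rw [← intervalIntegral.integral_Iic_sub_Iic (integrable_const _).integrableOn
      (integrable_const _).integrableOn]
    simp
  rw [h]
  exact ((integrable_const (1:ℝ)).continuous_primitive 0).add continuous_const

/-- Probability integral transform for a diffuse finite measure. -/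
theorem map_measureReal_Iic {m : Measure ℝ} [IsFiniteMeasure m] (hm : ∀ x, m {x} = 0) :
    m.map (fun t => m.real (Iic t)) = volume.restrict (Icc 0 (m.real univ)) := by
  have hcont := continuous_measureReal_Iic hm
  have hmono : Monotone fun t => m.real (Iic t) :=
    fun a b hab => measureReal_mono (Iic_subset_Iic.2 hab)
  have hle : ∀ t, m.real (Iic t) ≤ m.real univ := fun t => measureReal_mono (subset_univ _)
  have hsurj : ∀ r, 0 < r → r < m.real univ → ∃ s, m.real (Iic s) = r := by
    intro r h0 h1
    have hbot : Tendsto (fun t => m.real (Iic t)) atBot (nhds 0) := by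
      have h := tendsto_measure_iInter_atBot (μ := m)
        (fun t : ℝ => measurableSet_Iic.nullMeasurableSet) (fun _ _ => Iic_subset_Iic.2)
        ⟨0, measure_ne_top _ _⟩
      rw [iInter_Iic_eq_empty_iff.2 (by simp [range_id', not_bddBelow_univ]), measure_empty] at h
      exact (ENNReal.tendsto_toReal ENNReal.zero_ne_top).comp h
    have htop : Tendsto (fun t => m.real (Iic t)) atTop (nhds (m.real univ)) :=
      (ENNReal.tendsto_toReal (measure_ne_top _ _)).comp (tendsto_measure_Iic_atTop m)
    exact mem_range_of_exists_le_of_exists_ge hcont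
      ((hbot.eventually_lt_const h0).exists.imp fun _ h => h.le)
      ((htop.eventually_const_lt h1).exists.imp fun _ h => h.le)
  refine Measure.ext_of_Iic _ _ fun t => ?_
  rw [Measure.map_apply hcont.measurable measurableSet_Iic,
    Measure.restrict_apply measurableSet_Iic]
  rcases lt_or_ge t 0 with ht | ht
  · have h1 : (fun t => m.real (Iic t)) ⁻¹' Iic t = ∅ := by
      ext s
      simpa using ht.trans_le measureReal_nonneg
    have h2 : Iic t ∩ Icc 0 (m.real univ) = ∅ := by
      ext s
      simp only [mem_inter_iff, mem_Iic, mem_Icc, mem_empty_iff_false, iff_false]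
      grind
    rw [h1, h2]; simp
  rcases le_or_gt (m.real univ) t with hp | hp
  · have h1 : (fun t => m.real (Iic t)) ⁻¹' Iic t = univ :=
      eq_univ_of_forall fun s => (hle s).trans hp
    have h2 : Iic t ∩ Icc 0 (m.real univ) = Icc 0 (m.real univ) :=
      inter_eq_right.2 fun s hs => hs.2.trans hp
    rw [h1, h2, Real.volume_Icc, sub_zero, ofReal_measureReal]
  · have h2 : Iic t ∩ Icc 0 (m.real univ) = Icc 0 t := by
      ext s
      simp only [mem_inter_iff, mem_Iic, mem_Icc]
      grind
    rw [h2, Real.volume_Icc, sub_zero,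
      ← ofReal_measureReal (μ := m) (s := (fun t => m.real (Iic t)) ⁻¹' Iic t)]
    congr 1
    apply le_antisymm
    · refine le_of_forall_gt_imp_ge_of_dense fun r hr => ?_
      rcases le_or_gt (m.real univ) r with hr' | hr'
      · exact (measureReal_mono (subset_univ _)).trans hr'
      obtain ⟨s, hs⟩ := hsurj r (ht.trans_lt hr) hr'
      rw [← hs]
      refine measureReal_mono fun u hu => ?_
      by_contra hus
      have := hmono (not_le.1 hus).le
      have hu' : m.real (Iic u) ≤ t := hu
      simp only [hs] at this
      linarith
    · rcases ht.eq_or_lt with rfl | ht'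
      · exact measureReal_nonneg
      obtain ⟨s, hs⟩ := hsurj t ht' hp
      conv_lhs => rw [← hs]
      exact measureReal_mono fun u hu => (hmono hu).trans hs.le

theorem Atomless.exists_isUnif {Ω : Type*} [MeasurableSpace Ω] {P : Measure Ω}
    [IsProbabilityMeasure P] (hP : Atomless P) : ∃ U, IsUnif P U := by
  obtain ⟨Y, hY, hY0⟩ := hP.exists_diffuse
  have : IsProbabilityMeasure (P.map Y) := Measure.isProbabilityMeasure_map hY.aemeasurable
  have hm : ∀ x, P.map Y {x} = 0 := fun x => by
    rw [Measure.map_apply hY (measurableSet_singleton x), hY0]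
  have hG := (continuous_measureReal_Iic hm).measurable
  refine ⟨_, hG.comp hY, ?_⟩
  rw [← Measure.map_map hG hY, map_measureReal_Iic hm, unif01, probReal_univ]

theorem IsUnif.real_preimage {Ω : Type*} [MeasurableSpace Ω] {P : Measure Ω} {U : Ω → ℝ}
    (hU : IsUnif P U) {s : Set ℝ} (hs : MeasurableSet s) :
    P.real (U ⁻¹' s) = unif01.real s := by
  rw [← hU.2, map_measureReal_apply hU.1 hs]

theorem unif01_real_Iic {t : ℝ} (h0 : 0 ≤ t) : unif01.real (Iic t) = min t 1 := by
  rw [unif01, measureReal_restrict_apply measurableSet_Iic]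
  have : Iic t ∩ Icc 0 1 = Icc 0 (min t 1) := by
    ext s; simp only [mem_inter_iff, mem_Iic, mem_Icc]; grind
  rw [this, Real.volume_real_Icc_of_le (le_min h0 zero_le_one), sub_zero]

theorem IsUnif.real_le {Ω : Type*} [MeasurableSpace Ω] {P : Measure Ω} {U : Ω → ℝ}
    (hU : IsUnif P U) {t : ℝ} (h0 : 0 ≤ t) : P.real {ω | U ω ≤ t} = min t 1 :=
  (hU.real_preimage measurableSet_Iic).trans (unif01_real_Iic h0)

theorem IsUnif.ae_mem_Ioo {Ω : Type*} [MeasurableSpace Ω] {P : Measure Ω} {U : Ω → ℝ}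
    (hU : IsUnif P U) : ∀ᵐ ω ∂P, U ω ∈ Ioo (0:ℝ) 1 := by
  refine ae_of_ae_map (p := fun x => x ∈ Ioo (0:ℝ) 1) hU.1.aemeasurable ?_
  rw [hU.2, unif01, ← Measure.restrict_congr_set Ioo_ae_eq_Icc]
  exact ae_restrict_mem measurableSet_Ioo

/-- Increasing rearrangement: a uniform variable can be made small on any given event. -/
theorem IsUnif.exists_rearrangement {Ω : Type*} [MeasurableSpace Ω] {P : Measure Ω}
    [IsProbabilityMeasure P] {U : Ω → ℝ} (hU : IsUnif P U) {A : Set Ω} (hA : MeasurableSet A) :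
    ∃ V, IsUnif P V ∧ ∀ ω ∈ A, 0 ≤ U ω → V ω ≤ U ω ∧ V ω ≤ P.real A := by
  classical
  have hdiff : ∀ B, ∀ x, (P.restrict B).map U {x} = 0 := by
    intro B x
    have h1 : P.map U {x} = 0 := by rw [hU.2]; simp [unif01]
    rw [Measure.map_apply hU.1 (measurableSet_singleton x)] at h1 ⊢
    exact le_antisymm ((Measure.restrict_apply_le _ _).trans h1.le) bot_le
  have huniv : ∀ B, ((P.restrict B).map U).real univ = P.real B := by
    intro B
    rw [map_measureReal_apply hU.1 MeasurableSet.univ]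
    simp [measureReal_def]
  set G : Set Ω → ℝ → ℝ := fun B t => ((P.restrict B).map U).real (Iic t) with hG
  have hGm : ∀ B, Measurable (G B) := fun B => (continuous_measureReal_Iic (hdiff B)).measurable
  have hGmap : ∀ B, (P.restrict B).map (fun ω => G B (U ω)) =
      volume.restrict (Icc 0 (P.real B)) := by
    intro B
    have h := map_measureReal_Iic (hdiff B)
    rw [huniv] at h
    rw [← h, Measure.map_map (hGm B) hU.1]
    rfl
  have hGle : ∀ B t, G B t = P.real (U ⁻¹' Iic t ∩ B) := by
    intro B t
    rw [hG]
    simp only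
    rw [map_measureReal_apply hU.1 measurableSet_Iic,
      measureReal_restrict_apply (hU.1 measurableSet_Iic)]
  have hm2 : Measurable fun ω => P.real A + G Aᶜ (U ω) :=
    ((hGm Aᶜ).comp hU.1).const_add _
  have hm1 : Measurable fun ω => G A (U ω) := (hGm A).comp hU.1
  have hVm : Measurable (A.piecewise (fun ω => G A (U ω)) (fun ω => P.real A + G Aᶜ (U ω))) :=
    Measurable.piecewise hA hm1 hm2
  refine ⟨A.piecewise (fun ω => G A (U ω)) (fun ω => P.real A + G Aᶜ (U ω)), ⟨hVm, ?_⟩, ?_⟩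
  · have hadd := Measure.map_add (P.restrict A) (P.restrict Aᶜ) hVm
    rw [Measure.restrict_add_restrict_compl hA] at hadd
    rw [hadd,
      Measure.map_congr (piecewise_ae_eq_restrict hA),
      Measure.map_congr (piecewise_ae_eq_restrict_compl hA), hGmap,
      ← Function.comp_def (fun x => P.real A + x) (fun ω => G Aᶜ (U ω)),
      ← Measure.map_map (measurable_const_add _) (by exact (hGm Aᶜ).comp hU.1), hGmap]
    have hc : P.real Aᶜ = 1 - P.real A := probReal_compl_eq_one_sub hA
    have h2 : (volume.restrict (Icc 0 (P.real Aᶜ))).map (fun x => P.real A + x) =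
        volume.restrict (Icc (P.real A) 1) := by
      have h3 := (measurePreserving_add_left volume (P.real A)).restrict_preimage
        (s := Icc (P.real A) 1) measurableSet_Icc
      rw [← h3.map_eq, hc]
      congr 2
      ext x
      simp only [mem_Icc, mem_preimage]
      constructor <;> rintro ⟨h, h'⟩ <;> constructor <;> linarith
    have hp0 : 0 ≤ P.real A := measureReal_nonneg
    have hp1 : P.real A ≤ 1 := measureReal_le_one
    rw [h2, ← Measure.restrict_congr_set (Ioc_ae_eq_Icc (a := P.real A)), unif01,
      ← Measure.restrict_union _ measurableSet_Ioc, Icc_union_Ioc_eq_Icc hp0 hp1]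
    exact disjoint_left.2 fun x hx hx' => (hx.2.trans_lt hx'.1).false
  · intro ω hω h0
    rw [piecewise_eq_of_mem _ _ _ hω, hGle]
    refine ⟨(measureReal_mono inter_subset_left).trans ?_, measureReal_mono inter_subset_right⟩
    exact (hU.real_le h0).le.trans (min_le_left _ _)

theorem cauchyQuantile_eq (p : ℝ) : cauchyQuantile p = -(tan (π * p))⁻¹ := by
  rw [cauchyQuantile, ← tan_pi_div_two_sub, ← tan_neg]
  congr 1; ring

theorem neg_inv_le_cauchyQuantile {p : ℝ} (hp : p ∈ Ioo (0:ℝ) 1) :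
    -(π * p)⁻¹ ≤ cauchyQuantile p := by
  have hx : 0 < π * p := mul_pos pi_pos hp.1
  rw [cauchyQuantile_eq, neg_le_neg_iff]
  rcases lt_or_ge (π * p) (π / 2) with h | h
  · exact inv_anti₀ hx (le_tan hx.le h)
  · have h1 : tan (π * p) ≤ 0 := by
      rw [← tan_sub_pi]
      refine tan_nonpos_of_nonpos_of_neg_pi_div_two_le ?_ (by linarith)
      nlinarith [hp.2, pi_pos]
    exact (inv_nonpos.2 h1).trans (inv_pos.2 hx).le

theorem cauchyQuantile_le {p : ℝ} (h0 : 0 < p) (h1 : p ≤ 1 / 2) :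
    cauchyQuantile p ≤ 1 - (π * p)⁻¹ := by
  have hx : 0 < π * p := mul_pos pi_pos h0
  have hx2 : π * p ≤ π / 2 := by nlinarith [pi_pos]
  have hcos : 0 ≤ cos (π * p) := cos_nonneg_of_mem_Icc ⟨by linarith, hx2⟩
  have hsin : 0 < sin (π * p) := sin_pos_of_pos_of_lt_pi hx (by linarith [pi_pos])
  have key : (π * p)⁻¹ - 1 ≤ (tan (π * p))⁻¹ := by
    rw [tan_eq_sin_div_cos, inv_div]
    calc (π * p)⁻¹ - 1 ≤ (1 - (π * p) ^ 2 / 2) / (π * p) := by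
          rw [le_div_iff₀ hx, sub_mul, inv_mul_cancel₀ hx.ne']
          nlinarith [pi_lt_four]
      _ ≤ cos (π * p) / (π * p) := by gcongr; exact one_sub_sq_div_two_le_cos
      _ ≤ cos (π * p) / sin (π * p) := div_le_div_of_nonneg_left hcos hsin (sin_le hx.le)
  rw [cauchyQuantile_eq]
  linarith

theorem cauchyCdf_mem_Icc (x : ℝ) : cauchyCdf x ∈ Icc (0:ℝ) 1 := by
  have h1 := arctan_lt_pi_div_two x
  have h2 := neg_pi_div_two_lt_arctan x
  have h3 : -(1 / 2) ≤ arctan x / π := by rw [le_div_iff₀ pi_pos]; linarith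
  have h4 : arctan x / π ≤ 1 / 2 := by rw [div_le_iff₀ pi_pos]; linarith
  constructor <;> rw [cauchyCdf] <;> linarith

theorem cauchyCdf_mono : Monotone cauchyCdf := fun x y h => by
  have := arctan_mono h
  rw [cauchyCdf, cauchyCdf]
  gcongr

theorem cauchyCdf_neg_le {w : ℝ} (hw : 0 < w) : cauchyCdf (-w) ≤ (π * w)⁻¹ := by
  have h1 := arctan_inv_of_pos hw
  have h2 : arctan w⁻¹ ≤ w⁻¹ := by
    have h := le_tan (arctan_nonneg.2 (inv_pos.2 hw).le) (arctan_lt_pi_div_two w⁻¹)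
    rwa [tan_arctan] at h
  have h3 : cauchyCdf (-w) = arctan w⁻¹ / π := by
    rw [cauchyCdf, arctan_neg, h1]
    field_simp
    ring
  rw [h3, div_le_iff₀ pi_pos]
  calc arctan w⁻¹ ≤ w⁻¹ := h2
    _ = (π * w)⁻¹ * π := by field_simp

theorem inv_pi_mul_inv_sub_one {y : ℝ} (h0 : 0 < y) (h1 : π * y < 1) :
    (π * ((π * y)⁻¹ - 1))⁻¹ = y / (1 - π * y) := by
  have : 1 - π * y ≠ 0 := by linarith
  have := pi_pos.ne'
  field_simp

theorem Mharm_le_iff {K : ℕ} (hK : 0 < K) {p : Fin K → ℝ} (hp : ∀ i, 0 < p i) {y : ℝ}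
    (hy : 0 < y) : Mharm K p ≤ y ↔ y⁻¹ ≤ (∑ i, (p i)⁻¹) / K := by
  have : NeZero K := ⟨hK.ne'⟩
  have hK' : (0:ℝ) < K := by exact_mod_cast hK
  have hs : 0 < ∑ i, (p i)⁻¹ :=
    Finset.sum_pos (fun i _ => inv_pos.2 (hp i)) Finset.univ_nonempty
  rw [Mharm, div_le_iff₀ hs, le_div_iff₀ hK', inv_mul_le_iff₀ hy]

theorem Mharm_mem_Icc {K : ℕ} (hK : 0 < K) {p : Fin K → ℝ} (hp : ∀ i, p i ∈ Ioo (0:ℝ) 1) :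
    Mharm K p ∈ Icc (0:ℝ) 1 := by
  refine ⟨div_nonneg K.cast_nonneg (Finset.sum_nonneg fun i _ => (inv_pos.2 (hp i).1).le), ?_⟩
  rw [Mharm_le_iff hK (fun i => (hp i).1) one_pos, inv_one, one_le_div (by exact_mod_cast hK)]
  calc (K : ℝ) = ∑ _i : Fin K, (1 : ℝ) := by simp
    _ ≤ ∑ i, (p i)⁻¹ :=
      Finset.sum_le_sum fun i _ => (one_le_inv₀ (hp i).1).2 (hp i).2.le

theorem exists_le_of_Mharm_le {K : ℕ} (hK : 0 < K) {p : Fin K → ℝ} (hp : ∀ i, 0 < p i) {y : ℝ}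
    (hy : Mharm K p ≤ y) : ∃ i, p i ≤ y := by
  have : NeZero K := ⟨hK.ne'⟩
  have hK' : (0:ℝ) < K := by exact_mod_cast hK
  have hs : 0 < ∑ i, (p i)⁻¹ :=
    Finset.sum_pos (fun i _ => inv_pos.2 (hp i)) Finset.univ_nonempty
  have hy0 : 0 < y := (div_pos hK' hs).trans_le hy
  rw [Mharm_le_iff hK hp hy0, le_div_iff₀ hK'] at hy
  by_contra! h
  have : ∑ i, (p i)⁻¹ < ∑ _i : Fin K, y⁻¹ :=
    Finset.sum_lt_sum_of_nonempty Finset.univ_nonempty fun i _ => inv_strictAnti₀ hy0 (h i)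
  simp only [Finset.sum_const, Finset.card_univ, Fintype.card_fin, nsmul_eq_mul] at this
  linarith

theorem Mharm_le_of_MCauchy_le {K : ℕ} (hK : 0 < K) {p : Fin K → ℝ}
    (hp : ∀ i, p i ∈ Ioo (0:ℝ) 1) {y : ℝ} (hy0 : 0 < y) (hy1 : π * y < 1)
    (h : MCauchy K p ≤ y) : Mharm K p ≤ y / (1 - π * y) := by
  have hK' : (0:ℝ) < K := by exact_mod_cast hK
  have hy2 : y ≤ 1 / 2 := by nlinarith [pi_gt_three]
  have h1 : (∑ i, cauchyQuantile (p i)) / K ≤ 1 - (π * y)⁻¹ := by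
    refine le_trans ?_ (cauchyQuantile_le hy0 hy2)
    rw [MCauchy, cauchyCdf, ← le_sub_iff_add_le, div_le_iff₀ pi_pos] at h
    have h2 : π * (y - 1 / 2) < π / 2 := by nlinarith [pi_pos]
    have h3 : -(π / 2) < π * (y - 1 / 2) := by nlinarith [pi_pos]
    rw [cauchyQuantile, ← arctan_le_arctan_iff, arctan_tan h3 h2]
    linarith
  have h2 : -((∑ i, (p i)⁻¹) / K / π) ≤ (∑ i, cauchyQuantile (p i)) / K := by
    have h3 : ∑ i, -(π * p i)⁻¹ ≤ ∑ i, cauchyQuantile (p i) :=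
      Finset.sum_le_sum fun i _ => neg_inv_le_cauchyQuantile (hp i)
    have h4 : ∑ i, -(π * p i)⁻¹ = -((∑ i, (p i)⁻¹) / π) := by
      rw [Finset.sum_div, ← Finset.sum_neg_distrib]
      refine Finset.sum_congr rfl fun i _ => ?_
      rw [mul_inv, mul_comm, div_eq_mul_inv]
    rw [h4] at h3
    calc -((∑ i, (p i)⁻¹) / K / π) = -((∑ i, (p i)⁻¹) / π) / K := by ring
      _ ≤ _ := by gcongr
  rw [Mharm_le_iff hK (fun i => (hp i).1) (div_pos hy0 (by linarith)),
    ← inv_pi_mul_inv_sub_one hy0 hy1, inv_inv, ← le_div_iff₀' pi_pos]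
  linarith

theorem MCauchy_le_of_Mharm_le {K : ℕ} (hK : 0 < K) {p q : Fin K → ℝ} (hp : ∀ i, 0 < p i)
    (hq : ∀ i, 0 < q i) (hqp : ∀ i, q i ≤ p i) (hq2 : ∀ i, q i ≤ 1 / 2) {y : ℝ} (hy0 : 0 < y)
    (hy1 : π * y < 1) (h : Mharm K p ≤ y) : MCauchy K q ≤ y / (1 - π * y) := by
  have hK' : (0:ℝ) < K := by exact_mod_cast hK
  rw [Mharm_le_iff hK hp hy0, le_div_iff₀ hK'] at h
  have hw : 0 < (π * y)⁻¹ - 1 := sub_pos.2 ((one_lt_inv₀ (mul_pos pi_pos hy0)).2 hy1)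
  rw [← inv_pi_mul_inv_sub_one hy0 hy1]
  refine (cauchyCdf_mono ?_).trans (cauchyCdf_neg_le hw)
  rw [div_le_iff₀ hK']
  calc ∑ i, cauchyQuantile (q i) ≤ ∑ i, (1 - π⁻¹ * (p i)⁻¹) := by
        refine Finset.sum_le_sum fun i _ => (cauchyQuantile_le (hq i) (hq2 i)).trans ?_
        rw [mul_inv]
        have := inv_anti₀ (hq i) (hqp i)
        gcongr
    _ = K - π⁻¹ * ∑ i, (p i)⁻¹ := by
        rw [Finset.sum_sub_distrib, Finset.mul_sum]; simp
    _ ≤ K - π⁻¹ * (y⁻¹ * K) := by gcongr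
    _ = -((π * y)⁻¹ - 1) * K := by rw [mul_inv]; ring

theorem VAD_nonneg_and_le {Ω : Type*} [MeasurableSpace Ω] {P : Measure Ω}
    [IsProbabilityMeasure P] {K : ℕ} {F : (Fin K → ℝ) → ℝ}
    (hF : ∀ p : Fin K → ℝ, (∀ i, p i ∈ Ioo (0:ℝ) 1) → 0 ≤ F p) {ε : ℝ} (hε : 0 < ε) :
    0 ≤ VAD P K F ε ∧ ∀ (U : Fin K → Ω → ℝ) (y : ℝ), (∀ i, IsUnif P (U i)) →
      ε ≤ P.real {ω | F (fun i => U i ω) ≤ y} → VAD P K F ε ≤ y := by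
  have hpos : ∀ (U : Fin K → Ω → ℝ), (∀ i, IsUnif P (U i)) → ∀ x,
      ε ≤ P.real {ω | F (fun i => U i ω) ≤ x} → 0 ≤ x := by
    intro U hU x hx
    by_contra! hx0
    have hnull : P {ω | F (fun i => U i ω) ≤ x} = 0 := by
      refine measure_eq_zero_iff_ae_notMem.2 ?_
      filter_upwards [ae_all_iff.2 fun i => (hU i).ae_mem_Ioo] with ω hω
      exact fun h => absurd (hx0.trans_le (hF _ hω)) (not_lt.2 h)
    rw [measureReal_def, hnull] at hx
    exact absurd hx (not_le.2 hε)
  have hq : ∀ (U : Fin K → Ω → ℝ), (∀ i, IsUnif P (U i)) →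
      0 ≤ lQuantile P (fun ω => F (fun i => U i ω)) ε :=
    fun U hU => Real.sInf_nonneg fun x hx => hpos U hU x hx
  refine ⟨Real.sInf_nonneg ?_, fun U y hU hy => ?_⟩
  · rintro _ ⟨U, hU, rfl⟩
    exact hq U hU
  · have h1 : VAD P K F ε ≤ lQuantile P (fun ω => F (fun i => U i ω)) ε := by
      refine csInf_le ⟨0, ?_⟩ ⟨U, hU, rfl⟩
      rintro _ ⟨U, hU, rfl⟩
      exact hq U hU
    exact h1.trans (csInf_le ⟨0, fun x hx => hpos U hU x hx⟩ hy)

theorem lQuantile_set_nonempty {Ω : Type*} [MeasurableSpace Ω] {P : Measure Ω}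
    [IsProbabilityMeasure P] {K : ℕ} {F : (Fin K → ℝ) → ℝ}
    (hF : ∀ p : Fin K → ℝ, (∀ i, p i ∈ Ioo (0:ℝ) 1) → F p ≤ 1) {ε : ℝ} (hε : ε ≤ 1)
    {U : Fin K → Ω → ℝ} (hU : ∀ i, IsUnif P (U i)) :
    {x : ℝ | ε ≤ (P {ω | F (fun i => U i ω) ≤ x}).toReal}.Nonempty := by
  refine ⟨1, ?_⟩
  have h : P {ω | F (fun i => U i ω) ≤ 1} = 1 := by
    rw [← measure_univ (μ := P)]
    refine measure_congr (eventuallyEq_univ.2 ?_)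
    filter_upwards [ae_all_iff.2 fun i => (hU i).ae_mem_Ioo] with ω hω using hF _ hω
  simpa [h] using hε

theorem exists_of_VAD_lt {Ω : Type*} [MeasurableSpace Ω] {P : Measure Ω}
    [IsProbabilityMeasure P] (hP : Atomless P) {K : ℕ} {F : (Fin K → ℝ) → ℝ}
    (hF : ∀ p : Fin K → ℝ, (∀ i, p i ∈ Ioo (0:ℝ) 1) → F p ≤ 1) {ε : ℝ} (hε : ε ≤ 1) {y : ℝ}
    (hy : VAD P K F ε < y) :
    ∃ U : Fin K → Ω → ℝ, (∀ i, IsUnif P (U i)) ∧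
      ε ≤ P.real {ω | F (fun i => U i ω) ≤ y} := by
  obtain ⟨U₀, hU₀⟩ := hP.exists_isUnif
  have hne : {y : ℝ | ∃ U : Fin K → Ω → ℝ, (∀ i, IsUnif P (U i)) ∧
      y = lQuantile P (fun ω => F (fun i => U i ω)) ε}.Nonempty :=
    ⟨_, fun _ => U₀, fun _ => hU₀, rfl⟩
  obtain ⟨_, ⟨U, hU, rfl⟩, hlt⟩ := exists_lt_of_csInf_lt hne hy
  obtain ⟨x, hx, hxy⟩ := exists_lt_of_csInf_lt (lQuantile_set_nonempty hF hε hU) hlt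
  exact ⟨U, hU, le_trans hx (measureReal_mono fun ω hω => le_trans hω hxy.le)⟩

theorem real_Mharm_le {Ω : Type*} [MeasurableSpace Ω] {P : Measure Ω}
    [IsProbabilityMeasure P] {K : ℕ} (hK : 0 < K) {U : Fin K → Ω → ℝ}
    (hU : ∀ i, IsUnif P (U i)) {y : ℝ} (hy : 0 ≤ y) :
    P.real {ω | Mharm K (fun i => U i ω) ≤ y} ≤ K * y := by
  calc P.real {ω | Mharm K (fun i => U i ω) ≤ y} ≤ P.real (⋃ i, {ω | U i ω ≤ y}) := by
        refine ENNReal.toReal_mono (measure_ne_top _ _) (measure_mono_ae ?_)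
        filter_upwards [ae_all_iff.2 fun i => (hU i).ae_mem_Ioo] with ω hω h
        obtain ⟨i, hi⟩ := exists_le_of_Mharm_le hK (fun i => (hω i).1) h
        exact mem_iUnion.2 ⟨i, hi⟩
    _ ≤ ∑ i, P.real {ω | U i ω ≤ y} := measureReal_iUnion_fintype_le _
    _ ≤ ∑ _i : Fin K, y :=
        Finset.sum_le_sum fun i _ => ((hU i).real_le hy).le.trans (min_le_left _ _)
    _ = K * y := by simp

theorem VAD_Mharm_mem_Icc {Ω : Type*} [MeasurableSpace Ω] {P : Measure Ω}
    [IsProbabilityMeasure P] (hP : Atomless P) {K : ℕ} (hK : 0 < K) {ε : ℝ} (h0 : 0 < ε)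
    (h1 : ε ≤ 1) : VAD P K (Mharm K) ε ∈ Icc (ε / K) ε := by
  have hK' : (0:ℝ) < K := by exact_mod_cast hK
  obtain ⟨U₀, hU₀⟩ := hP.exists_isUnif
  constructor
  · refine le_csInf ⟨_, fun _ => U₀, fun _ => hU₀, rfl⟩ ?_
    rintro _ ⟨U, hU, rfl⟩
    refine le_csInf (lQuantile_set_nonempty (fun p hp => (Mharm_mem_Icc hK hp).2) h1 hU)
      fun x hx => ?_
    have hx' : ε ≤ P.real {ω | Mharm K (fun i => U i ω) ≤ max x 0} :=
      le_trans hx <| measureReal_mono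
        fun ω (hω : Mharm K (fun i => U i ω) ≤ x) => show _ ≤ _ from hω.trans (le_max_left _ _)
    have h2 : ε / K ≤ max x 0 := by
      rw [div_le_iff₀' hK']
      exact hx'.trans (real_Mharm_le hK hU (le_max_right _ _))
    rcases le_max_iff.1 h2 with h | h
    · exact h
    · exact absurd h (not_le.2 (div_pos h0 hK'))
  · refine (VAD_nonneg_and_le (fun p hp => (Mharm_mem_Icc hK hp).1) h0).2 (fun _ => U₀) ε
      (fun _ => hU₀) ?_
    have h2 : ∀ ω, Mharm K (fun _ => U₀ ω) = U₀ ω := by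
      intro ω
      simp only [Mharm, Finset.sum_const, Finset.card_univ, Fintype.card_fin, nsmul_eq_mul]
      rw [div_mul_eq_div_div, div_self hK'.ne', one_div, inv_inv]
    simp only [h2]
    rw [hU₀.real_le h0.le, min_eq_left h1]

theorem VAD_MCauchy_le {Ω : Type*} [MeasurableSpace Ω] {P : Measure Ω}
    [IsProbabilityMeasure P] (hP : Atomless P) {K : ℕ} (hK : 0 < K) {ε : ℝ} (h0 : 0 < ε)
    (h1 : ε ≤ 1) {y : ℝ} (hy : VAD P K (Mharm K) ε < y) (hy1 : π * y < 1)
    (hy2 : K * y ≤ 1 / 2) : VAD P K (MCauchy K) ε ≤ y / (1 - π * y) := by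
  have hy0 : 0 < y :=
    (VAD_nonneg_and_le (fun p hp => (Mharm_mem_Icc hK hp).1) h0).1.trans_lt hy
  obtain ⟨U, hU, hUy⟩ := exists_of_VAD_lt hP (fun p hp => (Mharm_mem_Icc hK hp).2) h1 hy
  set A := {ω | Mharm K (fun i => U i ω) ≤ y} with hA
  have hAm : MeasurableSet A := by
    refine measurableSet_le (measurable_const.div ?_) measurable_const
    exact Finset.measurable_sum _ fun i _ => (hU i).1.inv
  choose V hV hVA using fun i => (hU i).exists_rearrangement hAm
  refine (VAD_nonneg_and_le (fun p _ => (cauchyCdf_mem_Icc _).1) h0).2 V _ hV (hUy.trans ?_)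
  refine ENNReal.toReal_mono (measure_ne_top _ _) (measure_mono_ae ?_)
  filter_upwards [ae_all_iff.2 fun i => (hU i).ae_mem_Ioo,
    ae_all_iff.2 fun i => (hV i).ae_mem_Ioo] with ω hω hω' h
  have hPA : P.real A ≤ 1 / 2 := (real_Mharm_le hK hU hy0.le).trans hy2
  exact MCauchy_le_of_Mharm_le hK (fun i => (hω i).1) (fun i => (hω' i).1)
    (fun i => (hVA i ω h (hω i).1.le).1) (fun i => (hVA i ω h (hω i).1.le).2.trans hPA) hy0 hy1 h

theorem VAD_Mharm_le {Ω : Type*} [MeasurableSpace Ω] {P : Measure Ω}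
    [IsProbabilityMeasure P] (hP : Atomless P) {K : ℕ} (hK : 0 < K) {ε : ℝ} (h0 : 0 < ε)
    (h1 : ε ≤ 1) {y : ℝ} (hy : VAD P K (MCauchy K) ε < y) (hy1 : π * y < 1) :
    VAD P K (Mharm K) ε ≤ y / (1 - π * y) := by
  have hy0 : 0 < y := (VAD_nonneg_and_le (fun p _ => (cauchyCdf_mem_Icc _).1) h0).1.trans_lt hy
  obtain ⟨U, hU, hUy⟩ := exists_of_VAD_lt hP (fun p _ => (cauchyCdf_mem_Icc _).2) h1 hy
  refine (VAD_nonneg_and_le (fun p hp => (Mharm_mem_Icc hK hp).1) h0).2 U _ hU (hUy.trans ?_)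
  refine ENNReal.toReal_mono (measure_ne_top _ _) (measure_mono_ae ?_)
  filter_upwards [ae_all_iff.2 fun i => (hU i).ae_mem_Ioo] with ω hω h
  exact Mharm_le_of_MCauchy_le hK hω hy0 hy1 h

/-- A bound valid just to the right of `a` passes to `a`. -/
theorem le_div_one_sub_pi_mul_of_forall_gt {a b c : ℝ} (ha : π * a < 1) (hc : a < c)
    (h : ∀ y, a < y → y < c → π * y < 1 → b ≤ y / (1 - π * y)) : b ≤ a / (1 - π * a) := by
  have hcont : ContinuousAt (fun y => y / (1 - π * y)) a :=
    ContinuousAt.div (by fun_prop) (by fun_prop) (by linarith)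
  refine ge_of_tendsto (hcont.tendsto.mono_left (nhdsWithin_le_nhds (s := Ioi a))) ?_
  have h2 : a < 1 / π := by rwa [lt_div_iff₀' pi_pos]
  filter_upwards [Ioo_mem_nhdsGT (lt_min hc h2)] with y hy
  refine h y hy.1 (hy.2.trans_le (min_le_left _ _)) ?_
  rw [← lt_div_iff₀' pi_pos]
  exact hy.2.trans_le (min_le_right _ _)

theorem VAD_ratio_mem_Icc {Ω : Type*} [MeasurableSpace Ω] {P : Measure Ω}
    [IsProbabilityMeasure P] (hP : Atomless P) {K : ℕ} (hK : 0 < K) {ε : ℝ} (h0 : 0 < ε)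
    (h1 : π * ε ≤ 1 / 4) (h2 : K * ε < 1 / 2) :
    VAD P K (MCauchy K) ε / VAD P K (Mharm K) ε ∈
      Icc (1 - 2 * π * ε) ((1 - π * ε)⁻¹) := by
  have hK' : (0:ℝ) < K := by exact_mod_cast hK
  have hε1 : ε ≤ 1 := by nlinarith [pi_gt_three]
  obtain ⟨hH0, hH1⟩ := VAD_Mharm_mem_Icc hP hK h0 hε1
  have hC0 := (VAD_nonneg_and_le (P := P) (K := K) (F := MCauchy K)
    (fun p _ => (cauchyCdf_mem_Icc _).1) h0).1
  have hCH := fun y => VAD_MCauchy_le (y := y) hP hK h0 hε1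
  have hHC := fun y => VAD_Mharm_le (y := y) hP hK h0 hε1
  set H := VAD P K (Mharm K) ε
  set C := VAD P K (MCauchy K) ε
  have hHpos : 0 < H := (div_pos h0 hK').trans_le hH0
  have hπH : π * H ≤ π * ε := by gcongr
  have hC1 : C ≤ H / (1 - π * H) := by
    refine le_div_one_sub_pi_mul_of_forall_gt (c := 1 / 2 / K) (by linarith) ?_
      fun y hy hyc hy1 => hCH y hy hy1 ?_
    · rw [lt_div_iff₀' hK']
      exact (mul_le_mul_of_nonneg_left hH1 hK'.le).trans_lt h2
    · rw [lt_div_iff₀' hK'] at hyc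
      exact hyc.le
  have hC2 : C ≤ H * (1 - π * ε)⁻¹ := hC1.trans <| by
    rw [div_eq_mul_inv]
    gcongr
    linarith
  have hinv : (1 - π * ε)⁻¹ ≤ 2 := inv_le_of_inv_le₀ (by norm_num) (by linarith)
  have hC3 : C ≤ 2 * ε := by nlinarith
  have hπC : π * C ≤ 2 * π * ε := by nlinarith [pi_pos]
  have hH2 : H ≤ C / (1 - π * C) :=
    le_div_one_sub_pi_mul_of_forall_gt (c := C + 1) (by linarith) (by linarith)
      fun y hy _ hy1 => hHC y hy hy1
  rw [le_div_iff₀ (by linarith)] at hH2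
  constructor
  · rw [le_div_iff₀ hHpos]
    nlinarith
  · rw [div_le_iff₀ hHpos]
    linarith

/-- the VAD thresholds of the Cauchy combination and of the harmonic
averaging method satisfy `a_C(ε)/a_H(ε) → 1` as `ε ↓ 0`. -/
theorem vad_cauchy_harmonic_equiv
    {Ω : Type*} [MeasurableSpace Ω] (P : MeasureTheory.Measure Ω)
    [MeasureTheory.IsProbabilityMeasure P] (hP : Atomless P)
    (K : ℕ) (hK : 2 ≤ K) :
    Filter.Tendsto
      (fun ε : ℝ => VAD P K (MCauchy K) ε / VAD P K (Mharm K) ε)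
      (nhdsWithin 0 (Set.Ioi 0)) (nhds 1) := by
  have hK0 : 0 < K := by omega
  have hmem : ∀ᶠ ε in nhdsWithin (0:ℝ) (Ioi 0),
      VAD P K (MCauchy K) ε / VAD P K (Mharm K) ε ∈ Icc (1 - 2 * π * ε) ((1 - π * ε)⁻¹) := by
    have e1 : ∀ᶠ ε in nhds (0:ℝ), π * ε < 1 / 4 :=
      ContinuousAt.eventually_lt (by fun_prop) (by fun_prop) (by norm_num)
    have e2 : ∀ᶠ ε in nhds (0:ℝ), (K : ℝ) * ε < 1 / 2 :=
      ContinuousAt.eventually_lt (by fun_prop) (by fun_prop) (by norm_num)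
    filter_upwards [self_mem_nhdsWithin, nhdsWithin_le_nhds e1, nhdsWithin_le_nhds e2]
      with ε h0 h1 h2 using VAD_ratio_mem_Icc hP hK0 h0 h1.le h2
  have t1 : Tendsto (fun ε : ℝ => 1 - 2 * π * ε) (nhdsWithin 0 (Ioi 0)) (nhds 1) := by
    have : ContinuousAt (fun ε : ℝ => 1 - 2 * π * ε) 0 := by fun_prop
    simpa using this.tendsto.mono_left (nhdsWithin_le_nhds (s := Ioi 0))
  have t2 : Tendsto (fun ε : ℝ => (1 - π * ε)⁻¹) (nhdsWithin 0 (Ioi 0)) (nhds 1) := by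
    have : ContinuousAt (fun ε : ℝ => (1 - π * ε)⁻¹) 0 :=
      ContinuousAt.inv₀ (by fun_prop) (by simp)
    simpa using this.tendsto.mono_left (nhdsWithin_le_nhds (s := Ioi 0))
  exact tendsto_of_tendsto_of_tendsto_of_le_of_le' t1 t2 (hmem.mono fun _ h => h.1)
    (hmem.mono fun _ h => h.2)
end

section
/- Let K ≥ 2 and r ∈ ℝ with r ≠ −1. Then it is NOT the case that M_{C,K}(p_1,…,p_K)/M_{r,K}(p_1,…,p_K) → 1 as max_{1≤i≤K} p_i ↓ 0; that is, there exist δ > 0 and a sequence of vectors p^{(n)} ∈ (0,1)^K with max_{1≤i≤K} p_i^{(n)} → 0 such that |M_{C,K}(p^{(n)})/M_{r,K}(p^{(n)}) − 1| ≥ δ for all n. -/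
open MeasureTheory ProbabilityTheory Real Set Filter

/-- generalized mean combining function `M_{r,K}`, with the geometric mean for `r = 0`. -/
noncomputable def Mgen (r : ℝ) (K : ℕ) (p : Fin K → ℝ) : ℝ :=
  if r = 0 then (∏ i, p i) ^ ((K : ℝ)⁻¹) else ((∑ i, p i ^ r) / (K : ℝ)) ^ r⁻¹

theorem tendsto_mul_inv_tan {a : ℝ} (ha : 0 < a) :
    Tendsto (fun t : ℝ => t * (Real.tan (a * t))⁻¹) (nhdsWithin 0 (Ioi 0)) (nhds a⁻¹) := by
  have hd : HasDerivAt (fun t : ℝ => Real.tan (a * t)) a 0 := by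
    have h1 : HasDerivAt (fun t : ℝ => a * t) a 0 := by
      simpa using (hasDerivAt_id (0 : ℝ)).const_mul a
    have h2 : HasDerivAt Real.tan 1 (a * 0) := by
      simpa using Real.hasDerivAt_tan (x := a * 0) (by simp)
    simpa [Function.comp_def] using h2.comp (0 : ℝ) h1
  have h := (hd.tendsto_slope.mono_left
    (nhdsWithin_mono 0 fun t (ht : 0 < t) => ht.ne')).inv₀ ha.ne'
  refine h.congr fun t => ?_
  simp [slope_def_field, div_eq_mul_inv, mul_comm]

theorem cauchyQuantile_eq_neg_inv_tan (p : ℝ) :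
    cauchyQuantile p = -(Real.tan (π * p))⁻¹ := by
  rw [cauchyQuantile, ← Real.tan_pi_div_two_sub, ← Real.tan_neg]
  congr 1
  ring

theorem cauchyCdf_of_neg {x : ℝ} (hx : x < 0) :
    cauchyCdf x = Real.arctan (-x⁻¹) / π := by
  have := Real.pi_pos
  rw [cauchyCdf, Real.arctan_neg, Real.arctan_inv_of_neg hx]
  field_simp
  ring

theorem tendsto_arctan_div {g : ℝ → ℝ} {c : ℝ}
    (hg : Tendsto (fun t => g t / t) (nhdsWithin 0 (Ioi 0)) (nhds c)) :
    Tendsto (fun t => Real.arctan (g t) / t) (nhdsWithin 0 (Ioi 0)) (nhds c) := by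
  have hid : Tendsto (fun t : ℝ => t) (nhdsWithin 0 (Ioi 0)) (nhds 0) :=
    tendsto_id.mono_left nhdsWithin_le_nhds
  have hg0 : Tendsto g (nhdsWithin 0 (Ioi 0)) (nhds 0) := by
    have h := hg.mul hid
    rw [mul_zero] at h
    refine h.congr' ?_
    filter_upwards [self_mem_nhdsWithin] with t (ht : 0 < t)
    exact div_mul_cancel₀ _ ht.ne'
  have hs : Tendsto (fun u => dslope Real.arctan 0 u) (nhds 0) (nhds 1) := by
    have h : ContinuousAt (dslope Real.arctan 0) 0 :=
      continuousAt_dslope_same.2 (Real.differentiableAt_arctan 0)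
    have h1 : dslope Real.arctan 0 0 = 1 := by simp [dslope_same]
    simpa only [h1] using h.tendsto
  have h := hg.mul (hs.comp hg0)
  rw [mul_one] at h
  refine h.congr fun t => ?_
  have := sub_smul_dslope Real.arctan 0 (g t)
  simp only [sub_zero, smul_eq_mul, Real.arctan_zero] at this
  rw [Function.comp_apply, ← this]
  ring

/-- Along a ray to the origin, the Cauchy combining function behaves like the harmonic mean. -/
theorem tendsto_MCauchy_div {K : ℕ} (hK : 0 < K) {v : Fin K → ℝ} (hv : ∀ i, 0 < v i) :
    Tendsto (fun t => MCauchy K (fun i => t * v i) / t) (nhdsWithin 0 (Ioi 0))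
      (nhds (K / ∑ i, (v i)⁻¹)) := by
  have hpi := Real.pi_pos
  have hK' : (0 : ℝ) < K := by exact_mod_cast hK
  have hS : 0 < ∑ i, (v i)⁻¹ :=
    Finset.sum_pos (fun i _ => inv_pos.2 (hv i)) ⟨⟨0, hK⟩, Finset.mem_univ _⟩
  set S : ℝ → ℝ := fun t => (∑ i, cauchyQuantile (t * v i)) / (K : ℝ) with hSdef
  have hlim : Tendsto (fun t => t * -S t) (nhdsWithin 0 (Ioi 0))
      (nhds ((∑ i, (π * v i)⁻¹) / K)) := by
    have h := (tendsto_finsetSum Finset.univ fun i _ =>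
      tendsto_mul_inv_tan (mul_pos hpi (hv i))).div_const (K : ℝ)
    refine h.congr fun t => ?_
    simp only [hSdef, cauchyQuantile_eq_neg_inv_tan, Finset.sum_neg_distrib, neg_div, neg_neg,
      ← Finset.mul_sum, mul_div_assoc]
    simp only [mul_assoc, mul_comm t]
  have hval : (∑ i, (π * v i)⁻¹) / (K : ℝ) = (∑ i, (v i)⁻¹) / (π * K) := by
    simp only [mul_inv, ← Finset.mul_sum]
    field_simp
  rw [hval] at hlim
  have hpos : 0 < (∑ i, (v i)⁻¹) / (π * K) := by positivity
  have hinv : Tendsto (fun t => -(S t)⁻¹ / t) (nhdsWithin 0 (Ioi 0))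
      (nhds ((∑ i, (v i)⁻¹) / (π * K))⁻¹) := by
    refine (hlim.inv₀ hpos.ne').congr fun t => ?_
    rw [mul_inv, inv_neg, div_eq_mul_inv, mul_comm]
  have h := (tendsto_arctan_div hinv).div_const π
  have hc : ((∑ i, (v i)⁻¹) / (π * K))⁻¹ / π = K / ∑ i, (v i)⁻¹ := by
    field_simp
  rw [hc] at h
  refine h.congr' ?_
  filter_upwards [self_mem_nhdsWithin, hlim.eventually (lt_mem_nhds hpos)] with t (ht : 0 < t) h0
  have hneg : S t < 0 := neg_pos.1 (pos_of_mul_pos_right h0 ht.le)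
  have hM : MCauchy K (fun i => t * v i) = cauchyCdf (S t) := rfl
  rw [hM, cauchyCdf_of_neg hneg]
  ring

theorem Mgen_mul {r : ℝ} {K : ℕ} (hK : 0 < K) {t : ℝ} (ht : 0 < t) {v : Fin K → ℝ}
    (hv : ∀ i, 0 < v i) : Mgen r K (fun i => t * v i) = t * Mgen r K v := by
  unfold Mgen
  split_ifs with h
  · rw [Finset.prod_mul_distrib, Real.mul_rpow (by simp; positivity)
      (Finset.prod_nonneg fun i _ => (hv i).le)]
    simp only [Finset.prod_const, Finset.card_univ, Fintype.card_fin]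
    rw [Real.pow_rpow_inv_natCast ht.le hK.ne']
  · have h1 : ∀ i, (t * v i) ^ r = t ^ r * v i ^ r := fun i => Real.mul_rpow ht.le (hv i).le
    simp only [h1, ← Finset.mul_sum, mul_div_assoc]
    rw [Real.mul_rpow (by positivity)
      (div_nonneg (Finset.sum_nonneg fun i _ => (Real.rpow_pos_of_pos (hv i) _).le)
        (Nat.cast_nonneg K)), Real.rpow_rpow_inv ht.le h]

theorem Mgen_pos {r : ℝ} {K : ℕ} (hK : 0 < K) {v : Fin K → ℝ}
    (hv : ∀ i, 0 < v i) : 0 < Mgen r K v := by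
  have hK' : (0 : ℝ) < K := by exact_mod_cast hK
  unfold Mgen
  split_ifs with h
  · exact Real.rpow_pos_of_pos (Finset.prod_pos fun i _ => hv i) _
  · exact Real.rpow_pos_of_pos (div_pos (Finset.sum_pos
      (fun i _ => Real.rpow_pos_of_pos (hv i) _) ⟨⟨0, hK⟩, Finset.mem_univ _⟩) hK') _

/-- The power function with exponent `s ≠ 0, 1` does not commute with averaging. -/
theorem exists_rpow_mean_ne {m : ℕ} (hm : 1 ≤ m) {s : ℝ} (h0 : s ≠ 0) (h1 : s ≠ 1) :
    ∃ x : ℝ, 1 ≤ x ∧ ((x + m) / (m + 1)) ^ s ≠ (x ^ s + m) / (m + 1) := by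
  have hm' : (1 : ℝ) ≤ m := by exact_mod_cast hm
  have hw : (1 : ℝ) / (m + 1) + m / (m + 1) = 1 := by field_simp; ring
  have e1 : ((1 : ℝ) / (m + 1)) • (2 : ℝ) + ((m : ℝ) / (m + 1)) • (1 : ℝ)
      = (2 + m) / (m + 1) := by
    simp only [smul_eq_mul]; ring
  have e2 : ((1 : ℝ) / (m + 1)) • (2 : ℝ) ^ s + ((m : ℝ) / (m + 1)) • (1 : ℝ) ^ s
      = (2 ^ s + m) / (m + 1) := by
    simp only [smul_eq_mul, Real.one_rpow]; ring
  rcases lt_or_gt_of_ne h0 with hs | hs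
  · set y : ℝ := (1 / 2 : ℝ) ^ s⁻¹ with hy
    have hy1 : 1 < y := Real.one_lt_rpow_of_pos_of_lt_one_of_neg (by norm_num) (by norm_num)
      (inv_lt_zero.2 hs)
    have hys : y ^ s = 1 / 2 := Real.rpow_inv_rpow (by norm_num) h0
    have hx : 1 ≤ (m + 1) * y - m := by nlinarith
    refine ⟨(m + 1) * y - m, hx, ne_of_lt ?_⟩
    have e : ((m + 1) * y - m + m) / (m + 1) = y := by field_simp; ring
    rw [e, hys, div_lt_div_iff₀ (by norm_num) (by positivity)]
    have := Real.rpow_pos_of_pos (lt_of_lt_of_le one_pos hx) s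
    linarith
  · refine ⟨2, by norm_num, ?_⟩
    rcases lt_or_gt_of_ne h1 with hs1 | hs1
    · have := (Real.strictConcaveOn_rpow hs hs1).2 (mem_Ici.2 zero_le_two) (mem_Ici.2 zero_le_one)
        (by norm_num) (by positivity) (by positivity) hw
      rw [e1, e2] at this
      exact this.ne'
    · have := (strictConvexOn_rpow hs1).2 (mem_Ici.2 zero_le_two) (mem_Ici.2 zero_le_one)
        (by norm_num) (by positivity) (by positivity) hw
      rw [e1, e2] at this
      exact this.ne

theorem exists_harmonic_mean_ne_Mgen {K : ℕ} (hK : 2 ≤ K) {r : ℝ} (hr : r ≠ -1) :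
    ∃ v : Fin K → ℝ, (∀ i, 0 < v i ∧ v i ≤ 1) ∧ (K : ℝ) / ∑ i, (v i)⁻¹ ≠ Mgen r K v := by
  obtain ⟨m, rfl⟩ : ∃ m, K = m + 1 := ⟨K - 1, by omega⟩
  have hm : (1 : ℝ) ≤ m := by exact_mod_cast (by omega : 1 ≤ m)
  suffices h : ∃ x : ℝ, 1 ≤ x ∧ ((m + 1 : ℕ) : ℝ) / (x + m) ≠
      Mgen r (m + 1) (Fin.cons x⁻¹ fun _ => 1) by
    obtain ⟨x, hx, h⟩ := h
    refine ⟨Fin.cons x⁻¹ fun _ => 1, fun i => ?_, ?_⟩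
    · refine Fin.cases ?_ (fun j => ?_) i
      · exact ⟨by simp; linarith, by simpa using inv_le_one_of_one_le₀ hx⟩
      · simp
    · simpa [Fin.sum_univ_succ] using h
  by_cases h0 : r = 0
  · refine ⟨2, by norm_num, ne_of_lt ?_⟩
    have hb := rpow_one_add_lt_one_add_mul_self (s := 1) (by norm_num) (by norm_num)
      (p := ((m + 1 : ℕ) : ℝ)⁻¹) (by positivity) (inv_lt_one_of_one_lt₀ (by push_cast; linarith))
    simp only [Mgen, if_pos h0, Fin.prod_univ_succ, Fin.cons_zero, Fin.cons_succ,
      Finset.prod_const_one, mul_one]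
    rw [Real.inv_rpow (by norm_num)]
    have e : ((m + 1 : ℕ) : ℝ) / (2 + m) = (1 + ((m + 1 : ℕ) : ℝ)⁻¹ * 1)⁻¹ := by
      push_cast; field_simp; ring
    rw [e]
    norm_num only at hb ⊢
    exact inv_strictAnti₀ (by positivity) (by simpa using hb)
  · obtain ⟨x, hx, h⟩ := exists_rpow_mean_ne (m := m) (by omega) (s := -r) (by simpa using h0)
      (fun h => hr (by linarith))
    refine ⟨x, hx, fun he => h ?_⟩
    have hx0 : 0 < x := by linarith
    simp only [Mgen, if_neg h0, Fin.sum_univ_succ, Fin.cons_zero, Fin.cons_succ, Real.one_rpow,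
      Finset.sum_const, Finset.card_univ, Fintype.card_fin, nsmul_eq_mul, mul_one] at he
    have hp := congrArg (fun z => z ^ r) he
    rw [Real.rpow_inv_rpow (by positivity) h0] at hp
    rw [Real.rpow_neg (by positivity), ← Real.inv_rpow (by positivity), inv_div,
      Real.rpow_neg hx0.le, ← Real.inv_rpow hx0.le]
    exact_mod_cast hp

/-- for `r ≠ -1`, `M_{C,K}/M_{r,K}` does NOT tend to `1` as
`max_i p_i ↓ 0`: there are `δ > 0` and vectors `p⁽ⁿ⁾` with `max_i p_i⁽ⁿ⁾ → 0` along
which the ratio stays at distance at least `δ` from `1`. -/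
theorem cauchy_not_equiv_Mr (K : ℕ) (hK : 2 ≤ K) (r : ℝ) (hr : r ≠ -1) :
    ∃ δ : ℝ, 0 < δ ∧ ∃ p : ℕ → Fin K → ℝ,
      (∀ n i, p n i ∈ Set.Ioo (0:ℝ) 1) ∧
      Filter.Tendsto
        (fun n => Finset.univ.sup' (Finset.univ_nonempty_iff.mpr ⟨⟨0, by omega⟩⟩) (p n))
        Filter.atTop (nhds 0) ∧
      ∀ n, δ ≤ |MCauchy K (p n) / Mgen r K (p n) - 1| := by
  obtain ⟨v, hv, hne⟩ := exists_harmonic_mean_ne_Mgen hK hr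
  have hK0 : 0 < K := by omega
  have hv0 : ∀ i, 0 < v i := fun i => (hv i).1
  have hM := Mgen_pos (r := r) hK0 hv0
  set L : ℝ := (K / ∑ i, (v i)⁻¹) / Mgen r K v with hL
  have hL1 : 0 < |L - 1| := abs_pos.2 (sub_ne_zero.2 fun h => hne ((div_eq_one_iff_eq hM.ne').1 h))
  have hlim : Tendsto (fun t => |MCauchy K (fun i => t * v i) / Mgen r K (fun i => t * v i) - 1|)
      (nhdsWithin 0 (Ioi 0)) (nhds |L - 1|) := by
    refine Tendsto.abs (Tendsto.sub_const ?_ 1)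
    refine ((tendsto_MCauchy_div hK0 hv0).div_const (Mgen r K v)).congr' ?_
    filter_upwards [self_mem_nhdsWithin] with t (ht : 0 < t)
    rw [Mgen_mul hK0 ht hv0, div_div]
  have hev := (hlim.eventually (lt_mem_nhds (half_lt_self hL1))).and
    (Ioo_mem_nhdsGT (zero_lt_one (α := ℝ)))
  have htend : Tendsto (fun n : ℕ => 1 / ((n : ℝ) + 1)) atTop (nhdsWithin 0 (Ioi 0)) :=
    tendsto_nhdsWithin_iff.2 ⟨tendsto_one_div_add_atTop_nhds_zero_nat,
      Eventually.of_forall fun n => by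
        simp only [mem_Ioi]
        positivity⟩
  obtain ⟨N, hN⟩ := eventually_atTop.1 (htend.eventually hev)
  set t : ℕ → ℝ := fun n => 1 / (((n + N : ℕ) : ℝ) + 1) with ht
  have ht0 : Tendsto t atTop (nhds 0) :=
    tendsto_one_div_add_atTop_nhds_zero_nat.comp (tendsto_add_atTop_nat N)
  have hgood : ∀ n, |L - 1| / 2 < |MCauchy K (fun i => t n * v i) /
      Mgen r K (fun i => t n * v i) - 1| ∧ t n ∈ Ioo (0 : ℝ) 1 :=
    fun n => hN (n + N) (Nat.le_add_left N n)
  have hle : ∀ n i, t n * v i ≤ t n := fun n i =>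
    mul_le_of_le_one_right (hgood n).2.1.le (hv i).2
  have hpos : ∀ n i, 0 < t n * v i := fun n i => mul_pos (hgood n).2.1 (hv0 i)
  refine ⟨|L - 1| / 2, half_pos hL1, fun n i => t n * v i,
    fun n i => ⟨hpos n i, (hle n i).trans_lt (hgood n).2.2⟩, ?_, fun n => (hgood n).1.le⟩
  refine squeeze_zero (fun n => ?_) (fun n => Finset.sup'_le _ _ fun i _ => hle n i) ht0
  exact (hpos n ⟨0, hK0⟩).le.trans (Finset.le_sup' (fun i => t n * v i) (Finset.mem_univ _))
end

section
/- Let K ≥ 1 and p_1,…,p_K ∈ (0,1]. Then M_{−1,K}(p_1,…,p_K) ≤ S_K(p_1,…,p_K) ≤ ℓ_K · M_{−1,K}(p_1,…,p_K). Moreover, the first inequality holds as an equality if p_1 = ⋯ = p_K, and the second inequality holds as an equality if p_{(k)} = k·p_{(1)} for all k = 1,…,K. -/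
open MeasureTheory ProbabilityTheory Real Set Filter

/-- Simes combining function `S_K(p) = min_i K·p_{(i)}/i`, where
`p_{(i)} = p (Tuple.sort p i)` is the `(i+1)`-th smallest order statistic. -/
noncomputable def simes (K : ℕ) (p : Fin K → ℝ) : ℝ :=
  sInf {y : ℝ | ∃ i : Fin K, y = (K : ℝ) * p (Tuple.sort p i) / ((i : ℕ) + 1)}

/-- `ℓ_K = Σ_{k=1}^K 1/k`. -/
noncomputable def ellK (K : ℕ) : ℝ := ∑ k ∈ Finset.range K, ((k : ℝ) + 1)⁻¹

theorem simes_le {K : ℕ} (p : Fin K → ℝ) (i : Fin K) :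
    simes K p ≤ (K : ℝ) * p (Tuple.sort p i) / ((i : ℕ) + 1) := by
  refine csInf_le (Set.Finite.bddBelow ?_) ⟨i, rfl⟩
  refine (Set.finite_range fun i : Fin K ↦
    (K : ℝ) * p (Tuple.sort p i) / ((i : ℕ) + 1)).subset ?_
  rintro y ⟨j, rfl⟩
  exact ⟨j, rfl⟩

theorem le_simes {K : ℕ} (hK : 1 ≤ K) (p : Fin K → ℝ) {c : ℝ}
    (h : ∀ i : Fin K, c ≤ (K : ℝ) * p (Tuple.sort p i) / ((i : ℕ) + 1)) :
    c ≤ simes K p := by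
  refine le_csInf ⟨_, ⟨0, hK⟩, rfl⟩ ?_
  rintro y ⟨j, rfl⟩
  exact h j

theorem sum_inv_sort {K : ℕ} (p : Fin K → ℝ) :
    ∑ i, (p (Tuple.sort p i))⁻¹ = ∑ i, (p i)⁻¹ :=
  Equiv.sum_comp (Tuple.sort p) fun i ↦ (p i)⁻¹

theorem ellK_eq_sum_fin (K : ℕ) : ellK K = ∑ i : Fin K, (((i : ℕ) : ℝ) + 1)⁻¹ :=
  Finset.sum_range fun k : ℕ ↦ ((k : ℝ) + 1)⁻¹

theorem sum_inv_pos {K : ℕ} (hK : 1 ≤ K) {p : Fin K → ℝ} (hp : ∀ i, 0 < p i) :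
    0 < ∑ i, (p i)⁻¹ :=
  Finset.sum_pos (fun i _ ↦ inv_pos.2 (hp i)) ⟨⟨0, hK⟩, Finset.mem_univ _⟩

theorem Mharm_le_simes {K : ℕ} (hK : 1 ≤ K) {p : Fin K → ℝ} (hp : ∀ i, 0 < p i) :
    Mharm K p ≤ simes K p := by
  refine le_simes hK p fun i ↦ ?_
  have hq := hp (Tuple.sort p i)
  have key : ((i : ℕ) + 1 : ℝ) * (p (Tuple.sort p i))⁻¹ ≤ ∑ j, (p j)⁻¹ := by
    rw [← sum_inv_sort]
    calc ((i : ℕ) + 1 : ℝ) * (p (Tuple.sort p i))⁻¹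
        = ∑ _j ∈ Finset.Iic i, (p (Tuple.sort p i))⁻¹ := by simp
      _ ≤ ∑ j ∈ Finset.Iic i, (p (Tuple.sort p j))⁻¹ :=
          Finset.sum_le_sum fun j hj ↦
            inv_anti₀ (hp _) (Tuple.monotone_sort p (Finset.mem_Iic.1 hj))
      _ ≤ ∑ j, (p (Tuple.sort p j))⁻¹ :=
          Finset.sum_le_sum_of_subset_of_nonneg (Finset.subset_univ _)
            fun j _ _ ↦ (inv_pos.2 (hp _)).le
  rw [← div_eq_mul_inv, div_le_iff₀ hq] at key
  rw [Mharm, div_le_div_iff₀ (sum_inv_pos hK hp) (by positivity), mul_assoc, mul_comm (p _)]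
  gcongr

theorem simes_le_ellK_mul_Mharm {K : ℕ} (hK : 1 ≤ K) {p : Fin K → ℝ} (hp : ∀ i, 0 < p i) :
    simes K p ≤ ellK K * Mharm K p := by
  rw [Mharm, ← mul_div_assoc, le_div_iff₀ (sum_inv_pos hK hp), ← sum_inv_sort, ellK_eq_sum_fin,
    Finset.mul_sum, Finset.sum_mul]
  refine Finset.sum_le_sum fun i _ ↦ ?_
  rw [← div_eq_mul_inv, div_le_iff₀ (hp _)]
  exact (simes_le p i).trans_eq (by ring)

theorem simes_le_Mharm_of_const {K : ℕ} (hK : 1 ≤ K) {p : Fin K → ℝ}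
    (h : ∀ i j, p i = p j) : simes K p ≤ Mharm K p := by
  have hK0 : (K : ℝ) ≠ 0 := by positivity
  have hlast : ((K - 1 : ℕ) : ℝ) + 1 = K := by
    exact_mod_cast Nat.sub_add_cancel hK
  refine (simes_le p ⟨K - 1, by omega⟩).trans_eq ?_
  rw [Mharm, Finset.sum_congr rfl fun i _ ↦
    congrArg (·⁻¹) (h i (Tuple.sort p ⟨K - 1, by omega⟩))]
  simp only [hlast, Finset.sum_const, Finset.card_univ, Fintype.card_fin, nsmul_eq_mul]
  rw [mul_div_cancel_left₀ _ hK0, div_mul_cancel_left₀ hK0, inv_inv]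

theorem ellK_mul_Mharm_le_simes {K : ℕ} (hK : 1 ≤ K) {p : Fin K → ℝ} {c : ℝ}
    (h : ∀ k : Fin K, p (Tuple.sort p k) = ((k : ℕ) + 1) * c) :
    ellK K * Mharm K p ≤ simes K p := by
  have hell : ellK K ≠ 0 :=
    (Finset.sum_pos (fun k _ ↦ by positivity) ⟨0, Finset.mem_range.2 hK⟩).ne'
  have hsum : ∑ i, (p i)⁻¹ = ellK K * c⁻¹ := by
    rw [← sum_inv_sort, ellK_eq_sum_fin, Finset.sum_mul]
    exact Finset.sum_congr rfl fun i _ ↦ by rw [h, mul_inv]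
  refine le_simes hK p fun i ↦ le_of_eq ?_
  have hi : ((i : ℕ) : ℝ) + 1 ≠ 0 := by positivity
  rw [h, Mharm, hsum]
  field_simp

/-- `M_{-1,K} ≤ S_K ≤ ℓ_K · M_{-1,K}` on `(0,1]^K`, with equality in the
first inequality when all `p_i` coincide, and in the second when `p_{(k)} = k·p_{(1)}`
for all `k`. -/
theorem harmonic_simes_inequalities (K : ℕ) (hK : 1 ≤ K)
    (p : Fin K → ℝ) (hp : ∀ i, p i ∈ Set.Ioc (0:ℝ) 1) :
    (Mharm K p ≤ simes K p ∧ simes K p ≤ ellK K * Mharm K p) ∧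
    ((∀ i j : Fin K, p i = p j) → Mharm K p = simes K p) ∧
    ((∀ k : Fin K, p (Tuple.sort p k) = ((k : ℕ) + 1) * p (Tuple.sort p ⟨0, by omega⟩)) →
      simes K p = ellK K * Mharm K p) := by
  have hpos : ∀ i, 0 < p i := fun i ↦ (hp i).1
  have hlow := Mharm_le_simes hK hpos
  have hupp := simes_le_ellK_mul_Mharm hK hpos
  exact ⟨⟨hlow, hupp⟩, fun h ↦ hlow.antisymm (simes_le_Mharm_of_const hK h),
    fun h ↦ hupp.antisymm (ellK_mul_Mharm_le_simes hK h)⟩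
end

section
/- Let K ≥ 1 and let V_1,…,V_K be independent uniform random variables on [0,1] with order statistics V_{(1)} ≤ ⋯ ≤ V_{(K)}. Then for every ε ∈ (0,1), P(min_{1≤i≤K} K·V_{(i)}/i > ε) = 1 − ε; equivalently, the Simes statistic S_K(V_1,…,V_K) is uniformly distributed on [0,1]. -/
open MeasureTheory ProbabilityTheory Real Set Filter

/-- The number of coordinates of `p` indexed by `s` that are at most `x`. -/
noncomputable def countLE {K : ℕ} (s : Finset (Fin K)) (p : Fin K → ℝ) (x : ℝ) : ℕ :=
  (s.filter fun j => p j ≤ x).card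

/-- The number of rejections of the linear step-up procedure with slope `c`. -/
noncomputable def stepUp {K : ℕ} (c : ℝ) (p : Fin K → ℝ) : ℕ :=
  Nat.findGreatest (fun m => m ≤ countLE Finset.univ p (c * m)) K

/-- The number of rejections of the linear step-up procedure with slope `c` when the
hypothesis `j` is rejected irrespective of `p j`. -/
noncomputable def stepUpForced {K : ℕ} (c : ℝ) (j : Fin K) (p : Fin K → ℝ) : ℕ :=
  Nat.findGreatest (fun m => m ≤ countLE (Finset.univ.erase j) p (c * m) + 1) K

section Counting

variable {K : ℕ}

lemma countLE_mono (s : Finset (Fin K)) (p : Fin K → ℝ) : Monotone (countLE s p) := by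
  intro x y hxy
  exact Finset.card_le_card (Finset.monotone_filter_right _ fun j _ hj => le_trans hj hxy)

lemma countLE_univ_le (p : Fin K → ℝ) (x : ℝ) : countLE Finset.univ p x ≤ K := by
  simpa [countLE] using Finset.card_filter_le (Finset.univ : Finset (Fin K)) fun j => p j ≤ x

lemma countLE_univ_eq_add (p : Fin K → ℝ) (x : ℝ) (j : Fin K) :
    countLE Finset.univ p x =
      countLE (Finset.univ.erase j) p x + if p j ≤ x then 1 else 0 := by
  simp only [countLE, Finset.card_filter]
  exact (Finset.sum_erase_add _ _ (Finset.mem_univ j)).symm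

lemma countLE_erase_update (p : Fin K → ℝ) (j : Fin K) (y x : ℝ) :
    countLE (Finset.univ.erase j) (Function.update p j y) x =
      countLE (Finset.univ.erase j) p x := by
  unfold countLE
  congr 1
  refine Finset.filter_congr fun i hi => ?_
  rw [Function.update_of_ne (Finset.ne_of_mem_erase hi)]

lemma sort_apply_le_iff (p : Fin K → ℝ) (x : ℝ) (i : Fin K) :
    p (Tuple.sort p i) ≤ x ↔ (i : ℕ) + 1 ≤ countLE Finset.univ p x := by
  have hmono : Monotone (p ∘ Tuple.sort p) := Tuple.monotone_sort p
  have hcard : countLE Finset.univ p x =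
      (Finset.univ.filter fun k => p (Tuple.sort p k) ≤ x).card := by
    simp only [countLE, Finset.card_filter]
    exact (Equiv.sum_comp (Tuple.sort p) fun k => if p k ≤ x then 1 else 0).symm
  rw [hcard]
  constructor
  · intro h
    rw [← Fin.card_Iic]
    refine Finset.card_le_card fun k hk => ?_
    simpa using (hmono (Finset.mem_Iic.1 hk)).trans h
  · intro h
    by_contra! hx
    have hle : (Finset.univ.filter fun k => p (Tuple.sort p k) ≤ x).card ≤ i := by
      rw [← Fin.card_Iio]
      refine Finset.card_le_card fun k hk => ?_
      rw [Finset.mem_Iio]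
      by_contra! hik
      exact (hx.trans_le (hmono hik)).not_ge (Finset.mem_filter.1 hk).2
    omega

end Counting

section StepUp

variable {K : ℕ} {c : ℝ}

lemma stepUp_le_countLE (c : ℝ) (p : Fin K → ℝ) :
    stepUp c p ≤ countLE Finset.univ p (c * stepUp c p) :=
  Nat.findGreatest_spec (P := fun m : ℕ => m ≤ countLE Finset.univ p (c * m))
    (Nat.zero_le K) (Nat.zero_le _)

lemma stepUpForced_le_countLE (c : ℝ) (j : Fin K) (p : Fin K → ℝ) :
    stepUpForced c j p ≤
      countLE (Finset.univ.erase j) p (c * stepUpForced c j p) + 1 :=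
  Nat.findGreatest_spec
    (P := fun m : ℕ => m ≤ countLE (Finset.univ.erase j) p (c * m) + 1)
    (Nat.zero_le K) (Nat.zero_le _)

lemma le_stepUp {p : Fin K → ℝ} {m : ℕ} (hm : m ≤ K)
    (h : m ≤ countLE Finset.univ p (c * m)) : m ≤ stepUp c p :=
  Nat.le_findGreatest hm h

lemma stepUp_le (c : ℝ) (p : Fin K → ℝ) : stepUp c p ≤ K :=
  Nat.findGreatest_le K

lemma stepUpForced_le (c : ℝ) (j : Fin K) (p : Fin K → ℝ) : stepUpForced c j p ≤ K :=
  Nat.findGreatest_le K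

lemma stepUpForced_pos (c : ℝ) (j : Fin K) (p : Fin K → ℝ) : 0 < stepUpForced c j p :=
  Nat.le_findGreatest (Fin.pos j) (Nat.le_add_left 1 _)

lemma stepUpForced_update (c : ℝ) (j : Fin K) (p : Fin K → ℝ) (y : ℝ) :
    stepUpForced c j (Function.update p j y) = stepUpForced c j p := by
  simp only [stepUpForced, countLE_erase_update]

lemma countLE_stepUp (hc : 0 ≤ c) (p : Fin K → ℝ) :
    countLE Finset.univ p (c * stepUp c p) = stepUp c p := by
  refine le_antisymm ?_ (stepUp_le_countLE c p)
  by_contra! h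
  have hK := countLE_univ_le p (c * stepUp c p)
  have hmono : countLE Finset.univ p (c * stepUp c p) ≤
      countLE Finset.univ p (c * (stepUp c p + 1 : ℕ)) :=
    countLE_mono _ _ (by push_cast; nlinarith)
  have := le_stepUp (c := c) (p := p) (m := stepUp c p + 1) (by omega) (by omega)
  omega

lemma stepUp_le_stepUpForced (c : ℝ) (j : Fin K) (p : Fin K → ℝ) :
    stepUp c p ≤ stepUpForced c j p := by
  refine Nat.le_findGreatest (stepUp_le c p) ?_
  have h := stepUp_le_countLE c p
  rw [countLE_univ_eq_add p _ j] at h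
  split_ifs at h <;> omega

lemma stepUpForced_eq_stepUp {j : Fin K} {p : Fin K → ℝ}
    (h : p j ≤ c * stepUpForced c j p) : stepUpForced c j p = stepUp c p := by
  refine le_antisymm (le_stepUp (stepUpForced_le c j p) ?_) (stepUp_le_stepUpForced c j p)
  rw [countLE_univ_eq_add p _ j, if_pos h]
  exact stepUpForced_le_countLE c j p

lemma le_mul_stepUpForced_iff (hc : 0 ≤ c) (j : Fin K) (p : Fin K → ℝ) :
    p j ≤ c * stepUpForced c j p ↔ 0 < stepUp c p ∧ p j ≤ c * stepUp c p := by
  constructor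
  · intro h
    rw [← stepUpForced_eq_stepUp h]
    exact ⟨stepUpForced_pos c j p, h⟩
  · rintro ⟨-, h⟩
    have : (stepUp c p : ℝ) ≤ stepUpForced c j p := by
      exact_mod_cast stepUp_le_stepUpForced c j p
    exact h.trans (mul_le_mul_of_nonneg_left this hc)

open scoped ENNReal in
lemma sum_stepUpForced_inv (hc : 0 ≤ c) (p : Fin K → ℝ) :
    ∑ j, (if p j ≤ c * stepUpForced c j p then (stepUpForced c j p : ℝ≥0∞)⁻¹ else 0) =
      if 0 < stepUp c p then 1 else 0 := by
  have hterm : ∀ j, (if p j ≤ c * stepUpForced c j p then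
      (stepUpForced c j p : ℝ≥0∞)⁻¹ else 0) =
      if 0 < stepUp c p ∧ p j ≤ c * stepUp c p then (stepUp c p : ℝ≥0∞)⁻¹ else 0 := by
    intro j
    by_cases h : p j ≤ c * stepUpForced c j p
    · rw [if_pos h, if_pos ((le_mul_stepUpForced_iff hc j p).1 h), stepUpForced_eq_stepUp h]
    · rw [if_neg h, if_neg (mt (le_mul_stepUpForced_iff hc j p).2 h)]
  simp only [hterm]
  by_cases hR : 0 < stepUp c p
  · have hcount := countLE_stepUp hc p
    simp only [hR, true_and, if_true]
    rw [← Finset.sum_filter, Finset.sum_const, nsmul_eq_mul]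
    change (countLE Finset.univ p (c * stepUp c p) : ℝ≥0∞) * _ = 1
    rw [hcount]
    exact ENNReal.mul_inv_cancel (by exact_mod_cast hR.ne') (ENNReal.natCast_ne_top _)
  · simp [hR]

end StepUp

section Measurability

variable {K : ℕ}

lemma measurable_countLE (s : Finset (Fin K)) (x : ℝ) :
    Measurable fun p : Fin K → ℝ => countLE s p x := by
  simp only [countLE, Finset.card_filter]
  refine Finset.measurable_fun_sum _ fun j _ => ?_
  exact Measurable.ite (measurableSet_le (measurable_pi_apply j) measurable_const)
    measurable_const measurable_const

lemma measurable_stepUp (c : ℝ) : Measurable (stepUp c : (Fin K → ℝ) → ℕ) :=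
  measurable_findGreatest fun _ _ =>
    measurableSet_le measurable_const (measurable_countLE _ _)

lemma measurable_stepUpForced (c : ℝ) (j : Fin K) : Measurable (stepUpForced c j) :=
  measurable_findGreatest fun _ _ =>
    measurableSet_le measurable_const ((measurable_countLE _ _).add_const 1)

end Measurability

lemma simes_le_iff {K : ℕ} (hK : 1 ≤ K) (ε : ℝ) (p : Fin K → ℝ) :
    simes K p ≤ ε ↔ 0 < stepUp (ε / K) p := by
  have hK0 : (0 : ℝ) < K := by exact_mod_cast hK
  have hset : {y : ℝ | ∃ i : Fin K, y = (K : ℝ) * p (Tuple.sort p i) / ((i : ℕ) + 1)} =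
      Set.range fun i : Fin K => (K : ℝ) * p (Tuple.sort p i) / ((i : ℕ) + 1) := by
    ext y
    simp [eq_comm]
  have hcoord : ∀ i : Fin K, (K : ℝ) * p (Tuple.sort p i) / ((i : ℕ) + 1) ≤ ε ↔
      (i : ℕ) + 1 ≤ countLE Finset.univ p (ε / K * ((i : ℕ) + 1 : ℕ)) := by
    intro i
    rw [← sort_apply_le_iff, div_le_iff₀ (by positivity), div_mul_eq_mul_div,
      le_div_iff₀ hK0, mul_comm]
    push_cast
    rfl
  have : Nonempty (Fin K) := ⟨⟨0, hK⟩⟩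
  have hfin := Set.finite_range
    fun i : Fin K => (K : ℝ) * p (Tuple.sort p i) / ((i : ℕ) + 1)
  rw [simes, hset]
  constructor
  · intro h
    obtain ⟨i, hi⟩ := (Set.range_nonempty _).csInf_mem hfin
    rw [← hi] at h
    exact (Nat.succ_pos _).trans_le (le_stepUp i.2 ((hcoord i).1 h))
  · intro h
    have hle := stepUp_le (ε / K) p
    let i : Fin K := ⟨stepUp (ε / K) p - 1, by omega⟩
    have hi : (i : ℕ) + 1 = stepUp (ε / K) p := Nat.sub_add_cancel h
    refine (csInf_le hfin.bddBelow (Set.mem_range_self i)).trans ((hcoord i).2 ?_)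
    rw [hi]
    exact stepUp_le_countLE _ _

lemma measurable_simes {K : ℕ} (hK : 1 ≤ K) : Measurable (simes K) := by
  refine measurable_of_Iic fun ε => ?_
  have : simes K ⁻¹' Set.Iic ε = {p | 0 < stepUp (ε / K) p} := by
    ext p
    exact simes_le_iff hK ε p
  rw [this]
  exact measurableSet_lt measurable_const (measurable_stepUp _)

lemma unif01_Iic {a : ℝ} (ha : a ≤ 1) : unif01 (Set.Iic a) = ENNReal.ofReal a := by
  have : Set.Iic a ∩ Set.Icc 0 1 = Set.Icc 0 a := by
    ext x
    simp only [Set.mem_inter_iff, Set.mem_Iic, Set.mem_Icc]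
    constructor
    · rintro ⟨h, h0, -⟩
      exact ⟨h0, h⟩
    · rintro ⟨h0, h⟩
      exact ⟨h, h0, h.trans ha⟩
  rw [unif01, Measure.restrict_apply measurableSet_Iic, this, Real.volume_Icc, sub_zero]

open scoped ENNReal in
lemma measurable_stepUpForced_inv {K : ℕ} (c : ℝ) (j : Fin K) :
    Measurable fun p : Fin K → ℝ =>
      if p j ≤ c * stepUpForced c j p then (stepUpForced c j p : ℝ≥0∞)⁻¹ else 0 := by
  have hR := measurable_stepUpForced c j
  refine Measurable.ite (measurableSet_le (measurable_pi_apply j) ?_) ?_ measurable_const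
  · exact ((measurable_from_nat (f := fun n : ℕ => (n : ℝ))).comp hR).const_mul c
  · exact (measurable_from_nat (f := fun n : ℕ => (n : ℝ≥0∞)⁻¹)).comp hR

open scoped ENNReal in
lemma lintegral_stepUpForced_inv {K : ℕ} {c : ℝ} (hc : 0 ≤ c) (hcK : c * K ≤ 1) (j : Fin K) :
    ∫⁻ p, (if p j ≤ c * stepUpForced c j p then (stepUpForced c j p : ℝ≥0∞)⁻¹ else 0)
      ∂(Measure.pi fun _ : Fin K => unif01) = ENNReal.ofReal c := by
  rw [lintegral_eq_of_lmarginal_eq {j} (measurable_stepUpForced_inv c j)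
    (measurable_const (a := ENNReal.ofReal c))]
  · simp
  funext p
  simp only [lmarginal_singleton, stepUpForced_update, Function.update_self, lintegral_const,
    measure_univ, mul_one]
  have hpos := stepUpForced_pos c j p
  have hle : c * stepUpForced c j p ≤ 1 :=
    (mul_le_mul_of_nonneg_left (by exact_mod_cast stepUpForced_le c j p) hc).trans hcK
  change ∫⁻ x, (Set.Iic (c * (stepUpForced c j p : ℝ))).indicator
    (fun _ => (stepUpForced c j p : ℝ≥0∞)⁻¹) x ∂unif01 = _
  rw [lintegral_indicator_const measurableSet_Iic, unif01_Iic hle, ENNReal.ofReal_mul hc,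
    ENNReal.ofReal_natCast, mul_comm, mul_assoc,
    ENNReal.mul_inv_cancel (by exact_mod_cast hpos.ne') (ENNReal.natCast_ne_top _), mul_one]

lemma measure_simes_le {K : ℕ} (hK : 1 ≤ K) {ε : ℝ} (h0 : 0 ≤ ε) (h1 : ε ≤ 1) :
    (Measure.pi fun _ : Fin K => unif01) {p | simes K p ≤ ε} = ENNReal.ofReal ε := by
  have hK0 : (0 : ℝ) < K := by exact_mod_cast hK
  have hc : 0 ≤ ε / K := by positivity
  have hcK : ε / K * K ≤ 1 := by rwa [div_mul_cancel₀ _ hK0.ne']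
  have hset : MeasurableSet {p : Fin K → ℝ | 0 < stepUp (ε / K) p} :=
    measurableSet_lt measurable_const (measurable_stepUp _)
  simp only [simes_le_iff hK]
  rw [← lintegral_indicator_one hset]
  have hind : ∀ p : Fin K → ℝ,
      {p : Fin K → ℝ | 0 < stepUp (ε / K) p}.indicator (1 : (Fin K → ℝ) → ENNReal) p =
      ∑ j, (if p j ≤ ε / K * stepUpForced (ε / K) j p then
        (stepUpForced (ε / K) j p : ENNReal)⁻¹ else 0) := by
    intro p
    rw [sum_stepUpForced_inv hc]
    simp [Set.indicator_apply]
  simp only [hind]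
  rw [lintegral_finsetSum]
  · simp only [lintegral_stepUpForced_inv hc hcK]
    rw [Finset.sum_const, Finset.card_univ, Fintype.card_fin, nsmul_eq_mul,
      ← ENNReal.ofReal_natCast, ← ENNReal.ofReal_mul hK0.le, mul_div_cancel₀ _ hK0.ne']
  · exact fun j _ => measurable_stepUpForced_inv _ j

/-- for independent uniforms, `P(S_K(V) > ε) = 1 - ε` for all
`ε ∈ (0,1)`; equivalently, the Simes statistic is uniformly distributed on `[0,1]`. -/
theorem simes_uniform (K : ℕ) (hK : 1 ≤ K) :
    (∀ ε ∈ Set.Ioo (0:ℝ) 1,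
      ((MeasureTheory.Measure.pi fun _ : Fin K => unif01)
        {p | ε < simes K p}).toReal = 1 - ε) ∧
    MeasureTheory.Measure.map (simes K)
      (MeasureTheory.Measure.pi fun _ : Fin K => unif01) = unif01 := by
  have hmeas := measurable_simes hK
  constructor
  · rintro ε ⟨h0, h1⟩
    have hcompl : {p | ε < simes K p} = {p | simes K p ≤ ε}ᶜ := by
      ext p
      simp
    rw [hcompl, ← measureReal_def,
      probReal_compl_eq_one_sub (measurableSet_le hmeas measurable_const), measureReal_def,
      measure_simes_le hK h0.le h1.le, ENNReal.toReal_ofReal h0.le]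
  · have : IsProbabilityMeasure
        (Measure.map (simes K) (Measure.pi fun _ : Fin K => unif01)) :=
      Measure.isProbabilityMeasure_map hmeas.aemeasurable
    have hIic : ∀ a : ℝ, 0 ≤ a → a ≤ 1 →
        Measure.map (simes K) (Measure.pi fun _ : Fin K => unif01) (Set.Iic a) =
          ENNReal.ofReal a := fun a h0 h1 => by
      rw [Measure.map_apply hmeas measurableSet_Iic]
      exact measure_simes_le hK h0 h1
    refine Measure.ext_of_Iic _ _ fun a => ?_
    rcases le_total a 1 with h1 | h1
    · rw [unif01_Iic h1]
      rcases le_total 0 a with h0 | h0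
      · exact hIic a h0 h1
      · rw [ENNReal.ofReal_of_nonpos h0]
        refine measure_mono_null (Set.Iic_subset_Iic.2 h0) ?_
        rw [hIic 0 le_rfl zero_le_one, ENNReal.ofReal_zero]
    · have hone : ∀ μ : Measure ℝ, IsProbabilityMeasure μ → μ (Set.Iic 1) = 1 →
          μ (Set.Iic a) = 1 := fun μ _ h =>
        le_antisymm prob_le_one (h ▸ measure_mono (Set.Iic_subset_Iic.2 h1))
      rw [hone _ this (by simp [hIic]), hone unif01 inferInstance (by simp [unif01_Iic])]
end
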